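/- For every k ≥ 2 and every natural number m ≥ 1 there exist Fatou–Bieberbach domains Ω₁, …, Ω_m in ℂ^k such that (i) Ω_i ∩ Ω_l = ∅ for all i ≠ l, and (ii) every point q ∈ ℂ^k \ (Ω₁ ∪ ⋯ ∪ Ω_m) lies in the topological boundary (frontier) of Ω_i for every i = 1, …, m. In particular the union Ω₁ ∪ ⋯ ∪ Ω_m is dense in ℂ^k. -/

import Mathlib

open Metric Set Filter

noncomputable section

/-- A Fatou–Bieberbach domain in `ℂ^k`: an open set `Ω ≠ ℂ^k` which is the range of an
injective entire map `ℂ^k → ℂ^k`. -/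
def IsFBDomain {k : ℕ} (Ω : Set (EuclideanSpace ℂ (Fin k))) : Prop :=
  IsOpen Ω ∧ Ω ≠ Set.univ ∧
    ∃ F : EuclideanSpace ℂ (Fin k) → EuclideanSpace ℂ (Fin k),
      Differentiable ℂ F ∧ Function.Injective F ∧ Set.range F = Ω

section push
open scoped Topology

variable {E : Type*} [NormedAddCommGroup E] [NormedSpace ℂ E]

/-- Limit of holomorphic maps in several variables, with summable differences. -/
theorem differentiableAt_of_summable_dist [CompleteSpace E] {f : ℕ → E → E} {g : E → E} {z₀ : E}
    {ε : ℝ} (hε : 0 < ε) {d : ℕ → ℝ} (hd : Summable d)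
    (hf : ∀ n, Differentiable ℂ (f n))
    (hfd : ∀ n, ∀ z ∈ ball z₀ ε, dist (f n z) (f (n+1) z) ≤ d n)
    (hlim : ∀ z ∈ ball z₀ ε, Tendsto (fun n => f n z) atTop (𝓝 (g z))) :
    DifferentiableAt ℂ g z₀ := by
  have hder : ∀ n, ∀ z ∈ ball z₀ (ε/2),
      dist (fderiv ℂ (f n) z) (fderiv ℂ (f (n+1)) z) ≤ 2 * d n / (ε/2) := by
    intro n z hz
    have hsub : ball z (ε/2) ⊆ ball z₀ ε := by
      apply ball_subset_ball'
      have := mem_ball.1 hz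
      linarith
    have h := Complex.norm_fderiv_le_div_of_mapsTo_ball (f := fun w => f n w - f (n+1) w) (c := z)
      (R₁ := ε/2) (R₂ := 2 * d n) ((hf n).sub (hf (n+1))).differentiableOn ?_ (by positivity)
    · rw [fderiv_fun_sub (hf n z) (hf (n+1) z)] at h
      rw [dist_eq_norm]
      exact h
    · intro w hw
      have h1 := hfd n w (hsub hw)
      have h2 := hfd n z (hsub (mem_ball_self (by positivity)))
      rw [mem_closedBall, dist_eq_norm]
      rw [dist_eq_norm] at h1 h2
      calc _ ≤ ‖f n w - f (n+1) w‖ + ‖f n z - f (n+1) z‖ := norm_sub_le _ _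
        _ ≤ _ := by linarith
  have hs : Summable (fun n => 2 * d n / (ε/2)) := (hd.mul_left 2).div_const _
  have hex : ∀ z, ∃ L : E →L[ℂ] E, z ∈ ball z₀ (ε/2) →
      Tendsto (fun n => fderiv ℂ (f n) z) atTop (𝓝 L) := by
    intro z
    by_cases hz : z ∈ ball z₀ (ε/2)
    · obtain ⟨L, hL⟩ := cauchySeq_tendsto_of_complete
        (cauchySeq_of_dist_le_of_summable _ (fun n => hder n z hz) hs)
      exact ⟨L, fun _ => hL⟩
    · exact ⟨0, fun h => absurd h hz⟩
  choose L hL using hex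
  have hu : TendstoUniformlyOn (fun n z => fderiv ℂ (f n) z) L atTop (ball z₀ (ε/2)) := by
    rw [Metric.tendstoUniformlyOn_iff]
    intro e he
    have ht : Tendsto (fun n => ∑' m, 2 * d (n + m) / (ε/2)) atTop (𝓝 0) := by
      have := tendsto_sum_nat_add (fun n => 2 * d n / (ε/2))
      simpa [add_comm] using this
    filter_upwards [ht.eventually (gt_mem_nhds he)] with n hn z hz
    rw [dist_comm]
    exact (dist_le_tsum_of_dist_le_of_tendsto _ (fun n => hder n z hz) hs (hL z hz) n).trans_lt hn
  exact (hasFDerivAt_of_tendstoUniformlyOn isOpen_ball hu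
    (fun n x _ => (hf n x).hasFDerivAt)
    (fun x hx => hlim x (ball_subset_ball (by linarith) hx))
    (mem_ball_self (by positivity))).differentiableAt

/-- A biholomorphic self-map. -/
def IsAut (Θ : Equiv.Perm E) : Prop :=
  Differentiable ℂ (Θ : E → E) ∧ Differentiable ℂ ((Θ⁻¹ : Equiv.Perm E) : E → E)

theorem IsAut.one : IsAut (1 : Equiv.Perm E) :=
  ⟨by simp, by simp⟩

theorem IsAut.mul {a b : Equiv.Perm E} (ha : IsAut a) (hb : IsAut b) : IsAut (a * b) := by
  refine ⟨?_, ?_⟩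
  · rw [Equiv.Perm.coe_mul]; exact ha.1.comp hb.1
  · rw [mul_inv_rev, Equiv.Perm.coe_mul]; exact hb.2.comp ha.2

theorem IsAut.inv {a : Equiv.Perm E} (ha : IsAut a) : IsAut a⁻¹ :=
  ⟨ha.2, by rw [inv_inv]; exact ha.1⟩

theorem IsAut.pow {a : Equiv.Perm E} (ha : IsAut a) (n : ℕ) : IsAut (a ^ n) := by
  induction n with
  | zero => simpa using IsAut.one
  | succ n ih => rw [pow_succ]; exact ih.mul ha

/-- The push-out data. -/
structure PushData (W : Set E) (Γ g : ℕ → Equiv.Perm E) (L : ℕ → Set E) (δ : ℕ → ℝ) : Prop where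
  open_W : IsOpen W
  step : ∀ n, Γ (n+1) = Γ n * g n
  autΓ : ∀ n, IsAut (Γ n)
  sum : Summable δ
  nonneg : ∀ n, 0 ≤ δ n
  fwd : ∀ n, ∀ z ∈ L n, dist (g n z) z ≤ δ n
  bwd : ∀ n, ∀ z ∈ L n, dist ((g n)⁻¹ z) z ≤ δ n
  exh : ∀ K ⊆ W, IsCompact K → ∃ N, ∀ n ≥ N, K ⊆ L n

namespace PushData
variable {W : Set E} {Γ g : ℕ → Equiv.Perm E} {L : ℕ → Set E} {δ : ℕ → ℝ}

/-- Tail sum. -/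
def tail (δ : ℕ → ℝ) (N : ℕ) : ℝ := ∑' j, δ (N + j)

theorem summable_add (h : PushData W Γ g L δ) (N : ℕ) : Summable (fun j => δ (N + j)) := by
  have := (summable_nat_add_iff N).2 h.sum
  simpa [add_comm] using this

theorem tail_succ (h : PushData W Γ g L δ) (N : ℕ) : tail δ N = δ N + tail δ (N+1) := by
  unfold tail
  rw [(h.summable_add N).tsum_eq_zero_add]
  simp only [add_zero]
  congr 2
  funext j
  congr 1
  ring

theorem tail_nonneg (h : PushData W Γ g L δ) (N : ℕ) : 0 ≤ tail δ N :=
  tsum_nonneg fun j => h.nonneg _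

theorem le_tail (h : PushData W Γ g L δ) (N n : ℕ) : δ (N + n) ≤ tail δ N :=
  (h.summable_add N).le_tsum n fun j _ => h.nonneg _

theorem tail_tendsto (h : PushData W Γ g L δ) : Tendsto (tail δ) atTop (𝓝 0) := by
  have := tendsto_sum_nat_add δ
  have e : tail δ = fun i => ∑' k, δ (k + i) := by
    funext i
    simp [tail, add_comm]
  rw [e]
  exact this

/-- Good pairs: N is late enough for the ball of radius `3ε`. -/
def Good (L : ℕ → Set E) (δ : ℕ → ℝ) (z₀ : E) (ε : ℝ) (N : ℕ) : Prop :=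
  (∀ j ≥ N, closedBall z₀ (3*ε) ⊆ L j) ∧ tail δ N < ε

theorem exists_good [ProperSpace E] (h : PushData W Γ g L δ) {z₀ : E} {ε : ℝ} (hε : 0 < ε)
    (hb : closedBall z₀ (3*ε) ⊆ W) : ∃ N₀, ∀ N ≥ N₀, Good L δ z₀ ε N := by
  obtain ⟨N₁, h₁⟩ := h.exh _ hb (isCompact_closedBall _ _)
  obtain ⟨N₂, h₂⟩ := eventually_atTop.1 (h.tail_tendsto.eventually (gt_mem_nhds hε))
  refine ⟨max N₁ N₂, fun N hN => ⟨fun j hj => h₁ j ?_, h₂ N ?_⟩⟩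
  · exact le_trans (le_trans (le_max_left _ _) hN) hj
  · exact le_trans (le_max_right _ _) hN

/-- the tail composites -/
def C (Γ : ℕ → Equiv.Perm E) (N n : ℕ) : Equiv.Perm E := (Γ N)⁻¹ * Γ (N + n)

theorem C_succ (h : PushData W Γ g L δ) (N n : ℕ) : C Γ N (n+1) = C Γ N n * g (N+n) := by
  unfold C
  rw [← add_assoc, h.step, mul_assoc]

theorem C_succ' (h : PushData W Γ g L δ) (N n : ℕ) : C Γ N (n+1) = g N * C Γ (N+1) n := by
  unfold C
  rw [h.step N, mul_inv_rev, ← mul_assoc, ← mul_assoc, mul_inv_cancel, one_mul,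
    show N + 1 + n = N + (n+1) by ring]

theorem C_close (h : PushData W Γ g L δ) {z₀ : E} {ε : ℝ} (n : ℕ) : ∀ {N : ℕ},
    Good L δ z₀ ε N → ∀ z ∈ closedBall z₀ (2*ε), dist (C Γ N n z) z ≤ tail δ N := by
  induction n with
  | zero => intro N hN z hz; simpa [C] using h.tail_nonneg N
  | succ n ih =>
    intro N hN z hz
    have hN' : Good L δ z₀ ε (N+1) := by
      refine ⟨fun j hj => hN.1 j (by omega), ?_⟩
      have := h.tail_succ N
      have := h.nonneg N
      have := hN.2
      linarith
    have h1 := ih hN' z hz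
    rw [h.C_succ', Equiv.Perm.mul_apply, h.tail_succ]
    have h2 : C Γ (N+1) n z ∈ closedBall z₀ (3*ε) := by
      rw [mem_closedBall] at hz ⊢
      have := dist_triangle (C Γ (N+1) n z) z z₀
      have := hN'.2
      linarith
    have h3 := h.fwd N _ (hN.1 N le_rfl h2)
    have := dist_triangle (g N (C Γ (N+1) n z)) (C Γ (N+1) n z) z
    linarith

theorem C_lip (h : PushData W Γ g L δ) {z₀ : E} {ε : ℝ} (hε : 0 < ε) (n : ℕ) {N : ℕ}
    (hN : Good L δ z₀ ε N) {z u : E} (hz : z ∈ closedBall z₀ ε) (hu : dist u z < ε) :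
    dist (C Γ N n u) (C Γ N n z) ≤ 3 * dist u z := by
  have haut : IsAut (C Γ N n) := (h.autΓ N).inv.mul (h.autΓ _)
  have hsub : ball z ε ⊆ closedBall z₀ (2*ε) := by
    intro w hw
    rw [mem_closedBall] at hz ⊢
    rw [mem_ball] at hw
    have := dist_triangle w z z₀
    linarith
  have key := Complex.dist_le_div_mul_dist_of_mapsTo_ball (f := fun w => C Γ N n w - w) (c := z)
    (z := u) (R₁ := ε) (R₂ := 2*ε) (haut.1.sub differentiable_id).differentiableOn ?_ hu
  · rw [mul_div_assoc, div_self hε.ne', mul_one, dist_eq_norm] at key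
    rw [dist_eq_norm]
    have e : C Γ N n u - C Γ N n z = (C Γ N n u - u - (C Γ N n z - z)) + (u - z) := by abel
    rw [e]
    refine (norm_add_le _ _).trans ?_
    rw [← dist_eq_norm u z]
    linarith
  · intro w hw
    have h1 := h.C_close n hN w (hsub hw)
    have h2 := h.C_close n hN z (hsub (mem_ball_self hε))
    rw [mem_closedBall, dist_eq_norm]
    rw [dist_eq_norm] at h1 h2
    have := norm_sub_le (C Γ N n w - w) (C Γ N n z - z)
    have := hN.2
    simp only
    linarith

theorem C_step (h : PushData W Γ g L δ) {z₀ : E} {ε : ℝ} (hε : 0 < ε) (n : ℕ) {N : ℕ}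
    (hN : Good L δ z₀ ε N) {z : E} (hz : z ∈ closedBall z₀ ε) :
    dist (C Γ N n z) (C Γ N (n+1) z) ≤ 3 * δ (N+n) := by
  have hzL : z ∈ L (N+n) := hN.1 _ (by omega) (closedBall_subset_closedBall (by linarith) hz)
  have h1 := h.fwd (N+n) z hzL
  have h2 : dist (g (N+n) z) z < ε := (h1.trans (h.le_tail N n)).trans_lt hN.2
  rw [h.C_succ, Equiv.Perm.mul_apply, dist_comm]
  have := h.C_lip hε n hN hz h2
  linarith

theorem exists_lim [CompleteSpace E] (h : PushData W Γ g L δ) {z₀ : E} {ε : ℝ} (hε : 0 < ε)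
    {N : ℕ} (hN : Good L δ z₀ ε N) {z : E} (hz : z ∈ closedBall z₀ ε) :
    ∃ w, Tendsto (fun n => C Γ N n z) atTop (𝓝 w) :=
  cauchySeq_tendsto_of_complete (cauchySeq_of_dist_le_of_summable _
    (fun n => h.C_step hε n hN hz) ((h.summable_add N).mul_left 3))

/-- Main limit theorem of the push-out method. -/
theorem main [ProperSpace E] (h : PushData W Γ g L δ) :
    ∃ G : E → E, DifferentiableOn ℂ G W ∧ InjOn G W ∧
      (∀ z ∈ W, Tendsto (fun n => (Γ n)⁻¹ (G z)) atTop (𝓝 z)) ∧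
      (∀ q n ε, (Γ n)⁻¹ q ∈ L n → (∀ j > n, closedBall ((Γ n)⁻¹ q) ε ⊆ L j) →
        closedBall ((Γ n)⁻¹ q) ε ⊆ W → tail δ n ≤ ε →
        ∃ z ∈ closedBall ((Γ n)⁻¹ q) ε, G z = q) ∧
      (∀ V ⊆ W, IsOpen V → IsOpen (G '' V)) := by
  have hball : ∀ V ⊆ W, IsOpen V → ∀ z₀ ∈ V, ∃ ε > 0, closedBall z₀ (3*ε) ⊆ V := by
    intro V _ hV z₀ hz₀
    obtain ⟨e, he, hb⟩ := Metric.isOpen_iff.1 hV z₀ hz₀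
    exact ⟨e/6, by positivity, (closedBall_subset_ball (by linarith)).trans hb⟩
  have hlim : ∀ z, ∃ w, z ∈ W → Tendsto (fun n => Γ n z) atTop (𝓝 w) := by
    intro z
    by_cases hz : z ∈ W
    · obtain ⟨ε, hε, hb⟩ := hball W subset_rfl h.open_W z hz
      obtain ⟨N, hN⟩ := h.exists_good hε hb
      obtain ⟨w, hw⟩ := h.exists_lim hε (hN N le_rfl) (mem_closedBall_self hε.le)
      refine ⟨Γ N w, fun _ => ?_⟩
      have := ((h.autΓ N).1.continuous.tendsto w).comp hw
      rw [← tendsto_add_atTop_iff_nat N]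
      refine this.congr fun n => ?_
      simp [C, add_comm]
    · exact ⟨0, fun h => absurd h hz⟩
  choose G hG using hlim
  have hC : ∀ z ∈ W, ∀ N, Tendsto (fun n => C Γ N n z) atTop (𝓝 ((Γ N)⁻¹ (G z))) := by
    intro z hz N
    have h1 := ((h.autΓ N).2.continuous.tendsto (G z)).comp
      ((tendsto_add_atTop_iff_nat N).2 (hG z hz))
    refine h1.congr fun n => ?_
    simp [C, add_comm]
  have hclose : ∀ z ∈ W, ∀ ε > 0, ∀ N, Good L δ z ε N → dist ((Γ N)⁻¹ (G z)) z ≤ tail δ N := by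
    intro z hz ε hε N hN
    exact le_of_tendsto ((hC z hz N).dist tendsto_const_nhds)
      (Eventually.of_forall fun n => h.C_close n hN z (mem_closedBall_self (by linarith)))
  have hinvlim : ∀ z ∈ W, Tendsto (fun n => (Γ n)⁻¹ (G z)) atTop (𝓝 z) := by
    intro z hz
    obtain ⟨ε, hε, hb⟩ := hball W subset_rfl h.open_W z hz
    obtain ⟨N, hN⟩ := h.exists_good hε hb
    rw [tendsto_iff_dist_tendsto_zero]
    refine squeeze_zero' (Eventually.of_forall fun _ => dist_nonneg) ?_ h.tail_tendsto
    filter_upwards [eventually_ge_atTop N] with n hn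
    exact hclose z hz ε hε n (hN n hn)
  have hcapt : ∀ q n ε, (Γ n)⁻¹ q ∈ L n → (∀ j > n, closedBall ((Γ n)⁻¹ q) ε ⊆ L j) →
        closedBall ((Γ n)⁻¹ q) ε ⊆ W → tail δ n ≤ ε →
        ∃ z ∈ closedBall ((Γ n)⁻¹ q) ε, G z = q := by
    intro q n ε hz hj hW ht
    have hb : ∀ m, dist ((Γ (n+m))⁻¹ q) ((Γ n)⁻¹ q) ≤ ∑ j ∈ Finset.range m, δ (n+j) ∧
        dist ((Γ (n+m))⁻¹ q) ((Γ (n+(m+1)))⁻¹ q) ≤ δ (n+m) := by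
      have hin : ∀ m, dist ((Γ (n+m))⁻¹ q) ((Γ n)⁻¹ q) ≤ ∑ j ∈ Finset.range m, δ (n+j) →
          dist ((Γ (n+m))⁻¹ q) ((Γ (n+(m+1)))⁻¹ q) ≤ δ (n+m) := by
        intro m hm
        have hmL : (Γ (n+m))⁻¹ q ∈ L (n+m) := by
          rcases Nat.eq_zero_or_pos m with rfl | hpos
          · simpa using hz
          · apply hj (n+m) (by omega)
            rw [mem_closedBall]
            refine hm.trans (le_trans ?_ ht)
            exact (h.summable_add n).sum_le_tsum _ fun j _ => h.nonneg _
        have := h.bwd _ _ hmL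
        rw [← add_assoc, h.step, mul_inv_rev, Equiv.Perm.mul_apply, dist_comm]
        exact this
      intro m
      suffices hs : dist ((Γ (n+m))⁻¹ q) ((Γ n)⁻¹ q) ≤ ∑ j ∈ Finset.range m, δ (n+j) from
        ⟨hs, hin m hs⟩
      induction m with
      | zero => simp
      | succ m ih =>
        have h1 := hin m ih
        rw [Finset.sum_range_succ]
        rw [dist_comm] at h1
        have := dist_triangle ((Γ (n+(m+1)))⁻¹ q) ((Γ (n+m))⁻¹ q) ((Γ n)⁻¹ q)
        linarith
    obtain ⟨z, hzl⟩ := cauchySeq_tendsto_of_complete (cauchySeq_of_dist_le_of_summable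
      (f := fun m => (Γ (n+m))⁻¹ q) _ (fun m => (hb m).2) (h.summable_add n))
    have hzb : z ∈ closedBall ((Γ n)⁻¹ q) ε := by
      refine isClosed_closedBall.mem_of_tendsto hzl (Eventually.of_forall fun m => ?_)
      rw [mem_closedBall]
      refine (hb m).1.trans (le_trans ?_ ht)
      exact (h.summable_add n).sum_le_tsum _ fun j _ => h.nonneg _
    refine ⟨z, hzb, ?_⟩
    have hzW := hW hzb
    obtain ⟨e, he, hbb⟩ := hball W subset_rfl h.open_W z hzW
    obtain ⟨N, hN⟩ := h.exists_good he hbb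
    have hN' := hN N le_rfl
    have hzl' : Tendsto (fun m => (Γ (N+m))⁻¹ q) atTop (𝓝 z) := by
      have h1 : Tendsto (fun m => (Γ m)⁻¹ q) atTop (𝓝 z) := by
        rw [← tendsto_add_atTop_iff_nat n]
        simpa [add_comm] using hzl
      have := (tendsto_add_atTop_iff_nat N).2 h1
      simpa [add_comm] using this
    have hd0 := tendsto_iff_dist_tendsto_zero.1 hzl'
    have hd1 : Tendsto (fun m => dist (C Γ N m ((Γ (N+m))⁻¹ q)) (C Γ N m z)) atTop (𝓝 0) := by
      refine squeeze_zero' (Eventually.of_forall fun _ => dist_nonneg) ?_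
        (by simpa using hd0.const_mul 3)
      filter_upwards [hd0.eventually (gt_mem_nhds he)] with m hm
      exact h.C_lip he m hN' (mem_closedBall_self he.le) hm
    have hd2 : Tendsto (fun m => dist (C Γ N m ((Γ (N+m))⁻¹ q)) (C Γ N m z)) atTop
        (𝓝 (dist ((Γ N)⁻¹ q) ((Γ N)⁻¹ (G z)))) := by
      refine Tendsto.dist ?_ (hC z hzW N)
      refine tendsto_const_nhds.congr fun m => ?_
      simp [C]
    have := tendsto_nhds_unique hd1 hd2
    have := dist_eq_zero.1 this.symm
    exact ((Γ N)⁻¹.injective this).symm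
  refine ⟨G, ?_, ?_, hinvlim, hcapt, ?_⟩
  · intro z hz
    apply DifferentiableAt.differentiableWithinAt
    obtain ⟨ε, hε, hb⟩ := hball W subset_rfl h.open_W z hz
    obtain ⟨N, hN⟩ := h.exists_good hε hb
    have h1 : DifferentiableAt ℂ (fun w => (Γ N)⁻¹ (G w)) z := by
      refine differentiableAt_of_summable_dist (f := fun n w => C Γ N n w) hε
        ((h.summable_add N).mul_left 3)
        (fun n => ((h.autΓ N).inv.mul (h.autΓ _)).1) ?_ ?_
      · intro n w hw
        exact h.C_step hε n (hN N le_rfl) (ball_subset_closedBall hw)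
      · intro w hw
        refine hC w (hb ?_) N
        exact closedBall_subset_closedBall (by linarith) (ball_subset_closedBall hw)
    have h2 := ((h.autΓ N).1.differentiableAt).comp z h1
    refine h2.congr_of_eventuallyEq (Eventually.of_forall fun w => ?_)
    simp
  · intro a ha b hb hab
    have h1 := hinvlim a ha
    rw [hab] at h1
    exact tendsto_nhds_unique h1 (hinvlim b hb)
  · intro V hVW hV
    rw [isOpen_iff_mem_nhds]
    rintro _ ⟨z, hz, rfl⟩
    obtain ⟨ε, hε, hb⟩ := hball V hVW hV z hz
    obtain ⟨N, hN⟩ := h.exists_good hε (hb.trans hVW)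
    have hN' := hN N le_rfl
    have h1 : dist ((Γ N)⁻¹ (G z)) z < 2*ε := by
      have := hclose z (hVW hz) ε hε N hN'
      have := hN'.2
      linarith
    have h2 : ∀ᶠ q in 𝓝 (G z), (Γ N)⁻¹ q ∈ ball z (2*ε) :=
      ((h.autΓ N).2.continuous.tendsto (G z)).eventually (isOpen_ball.mem_nhds h1)
    filter_upwards [h2] with q hq
    have hs : closedBall ((Γ N)⁻¹ q) ε ⊆ closedBall z (3*ε) := by
      apply closedBall_subset_closedBall'
      have := mem_ball.1 hq
      linarith
    obtain ⟨w, hw, hwq⟩ := hcapt q N ε (hN'.1 N le_rfl (hs (mem_closedBall_self hε.le)))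
      (fun j hj => hs.trans (hN'.1 j hj.le)) (hs.trans (hb.trans hVW)) hN'.2.le
    exact ⟨w, hb (hs hw), hwq⟩

end PushData
end push

section basin
open scoped Topology

variable {E : Type*} [NormedAddCommGroup E] [NormedSpace ℂ E]

theorem second_order [ProperSpace E] {F : E → E} (hF : Differentiable ℂ F) {p : E} {μ : ℂ}
    (hp : F p = p) (hd : HasFDerivAt F (μ • ContinuousLinearMap.id ℂ E) p) :
    ∃ C : ℝ, 0 ≤ C ∧ ∀ h : E, ‖h‖ ≤ 1 → ‖F (p + h) - p - μ • h‖ ≤ C * ‖h‖ ^ 2 := by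
  set f : E → E := fun z => F z - μ • z with hf
  have hfd : Differentiable ℂ f := hF.sub (differentiable_id.const_smul μ)
  obtain ⟨R, hR⟩ := (isCompact_closedBall p 2).exists_bound_of_continuousOn
    (f := fun z => f z - f p) (hfd.continuous.sub continuous_const).continuousOn
  have hR0 : 0 ≤ R := (norm_nonneg _).trans (hR p (mem_closedBall_self (by norm_num)))
  refine ⟨R, hR0, fun h hh => ?_⟩
  have key := Complex.dist_le_mul_div_pow_of_mapsTo_ball_of_isLittleO (f := f) (c := p)
    (z := p + h) (R₁ := 2) (R₂ := R) (n := 1) hfd.differentiableOn ?_ ?_ ?_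
  · rw [dist_eq_norm, dist_eq_norm, add_sub_cancel_left] at key
    have e : f (p + h) - f p = F (p + h) - p - μ • h := by
      simp only [hf, hp, smul_add]; abel
    rw [e] at key
    refine key.trans ?_
    have : (‖h‖ / 2) ^ (1+1) ≤ ‖h‖ ^ 2 := by nlinarith [norm_nonneg h]
    gcongr
  · intro z hz
    rw [mem_closedBall, dist_eq_norm]
    exact hR z (ball_subset_closedBall hz)
  · have := hd.isLittleO
    refine (this.congr_left fun z => ?_).trans_isBigO ?_
    · simp [hf, smul_sub]; abel
    · simpa using (Asymptotics.isBigO_refl (fun w : E => w - p) (𝓝 p)).norm_right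
  · rw [mem_ball, dist_eq_norm, add_sub_cancel_left]; linarith

/-- affine charts at `p` -/
def chart (p : E) (n : ℕ) : Equiv.Perm E where
  toFun z := p + ((1/8 : ℂ)^n) • z
  invFun w := ((8 : ℂ)^n) • (w - p)
  left_inv z := by
    simp [smul_smul]
  right_inv w := by
    simp [smul_smul]

theorem chart_apply (p : E) (n : ℕ) (z : E) : chart p n z = p + ((1/8 : ℂ)^n) • z := rfl
theorem chart_inv_apply (p : E) (n : ℕ) (z : E) :
    (chart p n)⁻¹ z = ((8 : ℂ)^n) • (z - p) := rfl

theorem chart_aut (p : E) (n : ℕ) : IsAut (chart p n) := by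
  constructor
  · exact (differentiable_id.const_smul _).const_add _
  · exact (differentiable_id.sub_const _).const_smul _

/-- Fixed-point data. -/
structure AttrData (A : Equiv.Perm E) (p : E) (C r : ℝ) : Prop where
  aut : IsAut A
  hC : 0 ≤ C
  hr : 0 < r
  hr1 : r ≤ 1
  hCr : C * r ≤ 1/16
  fwd : ∀ h : E, ‖h‖ ≤ 1 → ‖A (p + h) - p - (1/8 : ℂ) • h‖ ≤ C * ‖h‖ ^ 2
  bwd : ∀ h : E, ‖h‖ ≤ 1 → ‖A⁻¹ (p + h) - p - (8 : ℂ) • h‖ ≤ C * ‖h‖ ^ 2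

theorem AttrData.contr {A : Equiv.Perm E} {p : E} {C r : ℝ} (h : AttrData A p C r) {z : E}
    (hz : dist z p < r) : dist (A z) p ≤ 3/16 * dist z p := by
  have h1 := h.fwd (z - p) (by rw [← dist_eq_norm]; linarith [h.hr1])
  rw [add_sub_cancel] at h1
  rw [dist_eq_norm] at hz
  rw [dist_eq_norm, dist_eq_norm]
  have e : A z - p = (A z - p - (1/8 : ℂ) • (z - p)) + (1/8 : ℂ) • (z - p) := by abel
  have h2 : ‖A z - p‖ ≤ C * ‖z - p‖ ^ 2 + 1/8 * ‖z - p‖ := by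
    rw [e]
    refine (norm_add_le _ _).trans ?_
    rw [norm_smul]
    have : ‖(1/8 : ℂ)‖ = 1/8 := by norm_num
    rw [this]
    linarith
  have h3 : C * ‖z - p‖ ^ 2 ≤ 1/16 * ‖z - p‖ := by
    have : C * ‖z - p‖ ≤ 1/16 := (mul_le_mul_of_nonneg_left hz.le h.hC).trans h.hCr
    nlinarith [norm_nonneg (z - p)]
  linarith

theorem AttrData.contr_pow {A : Equiv.Perm E} {p : E} {C r : ℝ} (h : AttrData A p C r) {z : E}
    (hz : dist z p < r) (n : ℕ) : dist ((A^n) z) p ≤ (3/16)^n * dist z p := by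
  induction n with
  | zero => simp
  | succ n ih =>
    have h1 : dist ((A^n) z) p < r := by
      refine lt_of_le_of_lt (ih.trans ?_) hz
      exact mul_le_of_le_one_left dist_nonneg (pow_le_one₀ (by norm_num) (by norm_num))
    rw [pow_succ', Equiv.Perm.mul_apply]
    refine (h.contr h1).trans ?_
    rw [pow_succ']
    linarith

theorem AttrData.push {A : Equiv.Perm E} {p : E} {C r : ℝ} (h : AttrData A p C r) :
    PushData (univ : Set E) (fun n => (A⁻¹)^n * chart p n)
      (fun n => (chart p n)⁻¹ * A⁻¹ * chart p (n+1))
      (fun n => closedBall 0 (2^n)) (fun n => 8 * C * (1/2)^n) where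
  open_W := isOpen_univ
  step n := by rw [pow_succ]; group
  autΓ n := (h.aut.inv.pow n).mul (chart_aut p n)
  sum := (summable_geometric_of_lt_one (by norm_num) (by norm_num)).mul_left _
  nonneg n := by have := h.hC; positivity
  fwd n z hz := by
    have hz' : ‖z‖ ≤ 2^n := by simpa using hz
    have hn : ‖((1/8 : ℂ)^(n+1)) • z‖ = (1/8)^(n+1) * ‖z‖ := by
      rw [norm_smul]; simp
    have hle : ‖((1/8 : ℂ)^(n+1)) • z‖ ≤ (1/8) * (1/4)^n := by
      rw [hn]
      calc (1/8 : ℝ)^(n+1) * ‖z‖ ≤ (1/8)^(n+1) * 2^n := by gcongr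
        _ = 1/8 * (1/4)^n := by
          rw [pow_succ, mul_right_comm, ← mul_pow]; norm_num [mul_comm]
    have hle1 : ‖((1/8 : ℂ)^(n+1)) • z‖ ≤ 1 := by
      refine hle.trans ?_
      have : (1/4 : ℝ)^n ≤ 1 := pow_le_one₀ (by norm_num) (by norm_num)
      linarith
    have key := h.bwd _ hle1
    rw [Equiv.Perm.mul_apply, Equiv.Perm.mul_apply, chart_inv_apply, chart_apply, dist_eq_norm]
    set w := ((1/8 : ℂ)^(n+1)) • z with hw
    have hzw : z = ((8:ℂ)^n) • ((8:ℂ) • w) := by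
      rw [hw, smul_smul, smul_smul, pow_succ]
      have : (8:ℂ)^n * 8 * ((1/8)^n * (1/8)) = 1 := by
        rw [show (8:ℂ)^n * 8 * ((1/8)^n * (1/8)) = (8 * (1/8))^n by rw [mul_pow]; ring]
        norm_num
      rw [this, one_smul]
    have e : ((8:ℂ)^n) • (A⁻¹ (p + w) - p) - z
        = ((8:ℂ)^n) • (A⁻¹ (p + w) - p - (8:ℂ) • w) := by
      conv_lhs => rw [hzw]
      rw [← smul_sub]
    rw [e, norm_smul]
    have h8 : ‖(8:ℂ)^n‖ = 8^n := by simp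
    rw [h8]
    have hC := h.hC
    calc (8:ℝ)^n * ‖A⁻¹ (p + w) - p - (8:ℂ) • w‖ ≤ 8^n * (C * ((1/8) * (1/4)^n)^2) := by
          gcongr; exact key.trans (by gcongr)
      _ = C/64 * (1/2)^n := by
          have : (8:ℝ)^n * ((1/4)^n)^2 = (1/2)^n := by
            rw [← pow_mul, mul_comm n 2, pow_mul, ← mul_pow]; norm_num
          rw [mul_pow, ← this]; ring
      _ ≤ 8 * C * (1/2)^n := by gcongr; linarith
  bwd n z hz := by
    have hz' : ‖z‖ ≤ 2^n := by simpa using hz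
    have hn : ‖((1/8 : ℂ)^n) • z‖ = (1/8)^n * ‖z‖ := by
      rw [norm_smul]; simp
    have hle : ‖((1/8 : ℂ)^n) • z‖ ≤ (1/4)^n := by
      rw [hn]
      calc (1/8 : ℝ)^n * ‖z‖ ≤ (1/8)^n * 2^n := by gcongr
        _ = (1/4)^n := by
          rw [← mul_pow]; norm_num
    have hle1 : ‖((1/8 : ℂ)^n) • z‖ ≤ 1 :=
      hle.trans (pow_le_one₀ (by norm_num) (by norm_num))
    have key := h.fwd _ hle1
    rw [mul_inv_rev, mul_inv_rev, inv_inv, inv_inv, Equiv.Perm.mul_apply, Equiv.Perm.mul_apply,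
      chart_inv_apply, chart_apply, dist_eq_norm]
    set w := ((1/8 : ℂ)^n) • z with hw
    have hzw : z = ((8:ℂ)^(n+1)) • ((1/8:ℂ) • w) := by
      rw [hw, smul_smul, smul_smul, pow_succ]
      have : (8:ℂ)^n * 8 * (1/8) * ((1/8)^n) = 1 := by
        rw [show (8:ℂ)^n * 8 * (1/8) * ((1/8)^n) = (8 * (1/8))^n by rw [mul_pow]; ring]
        norm_num
      rw [this, one_smul]
    have e : ((8:ℂ)^(n+1)) • (A (p + w) - p) - z
        = ((8:ℂ)^(n+1)) • (A (p + w) - p - (1/8:ℂ) • w) := by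
      conv_lhs => rw [hzw]
      rw [← smul_sub]
    rw [e, norm_smul]
    have h8 : ‖(8:ℂ)^(n+1)‖ = 8^(n+1) := by simp
    rw [h8]
    have hC := h.hC
    calc (8:ℝ)^(n+1) * ‖A (p + w) - p - (1/8:ℂ) • w‖ ≤ 8^(n+1) * (C * ((1/4)^n)^2) := by
          gcongr; exact key.trans (by gcongr)
      _ = 8 * C * (1/2)^n := by
          have : (8:ℝ)^n * ((1/4)^n)^2 = (1/2)^n := by
            rw [← pow_mul, mul_comm n 2, pow_mul, ← mul_pow]; norm_num
          rw [← this]; ring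
  exh K _ hK := by
    obtain ⟨R, hR⟩ := hK.isBounded.subset_closedBall 0
    obtain ⟨N, hN⟩ := pow_unbounded_of_one_lt R (by norm_num : (1:ℝ) < 2)
    refine ⟨N, fun n hn => hR.trans (closedBall_subset_closedBall (hN.le.trans ?_))⟩
    exact pow_le_pow_right₀ (by norm_num) hn

/-- the basin of `p` -/
def basin (A : Equiv.Perm E) (p : E) (r : ℝ) : Set E := {y | ∃ n : ℕ, (A^n) y ∈ ball p r}

theorem AttrData.fb [ProperSpace E] {A : Equiv.Perm E} {p : E} {C r : ℝ}
    (h : AttrData A p C r) :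
    ∃ F : E → E, Differentiable ℂ F ∧ Function.Injective F ∧ range F = basin A p r := by
  obtain ⟨G, hGd, hGi, hGl, hGc, -⟩ := h.push.main
  refine ⟨G, differentiableOn_univ.1 hGd, injOn_univ.1 hGi, ?_⟩
  have hinv : ∀ n q, ((A⁻¹)^n * chart p n)⁻¹ q = ((8:ℂ)^n) • ((A^n) q - p) := by
    intro n q
    rw [mul_inv_rev, Equiv.Perm.mul_apply, chart_inv_apply, inv_pow, inv_inv]
  simp only [hinv] at hGl hGc
  ext y
  constructor
  · rintro ⟨z, rfl⟩
    have h1 := hGl z (mem_univ _)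
    have h2 : Tendsto (fun n : ℕ => ((1/8:ℂ)^n)) atTop (𝓝 0) :=
      tendsto_pow_atTop_nhds_zero_of_norm_lt_one (by norm_num)
    have h3 := h2.smul h1
    rw [zero_smul] at h3
    have h4 : Tendsto (fun n => (A^n) (G z) - p) atTop (𝓝 0) := by
      refine h3.congr fun n => ?_
      rw [smul_smul, ← mul_pow]; norm_num
    obtain ⟨n, hn⟩ := (h4.eventually (ball_mem_nhds 0 h.hr)).exists
    refine ⟨n, ?_⟩
    rw [mem_ball, dist_eq_norm]
    simpa using hn
  · rintro ⟨N, hN⟩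
    have hev : ∀ᶠ m : ℕ in atTop, (8:ℝ)^N * r * (3/4)^m + (1/2)^m < 1 := by
      have h1 : Tendsto (fun m : ℕ => (8:ℝ)^N * r * (3/4)^m + (1/2)^m) atTop (𝓝 0) := by
        have a := (tendsto_pow_atTop_nhds_zero_of_lt_one (r := (3/4:ℝ)) (by norm_num)
          (by norm_num)).const_mul ((8:ℝ)^N * r)
        have b := (tendsto_pow_atTop_nhds_zero_of_lt_one (r := (1/2:ℝ)) (by norm_num)
          (by norm_num))
        simpa using a.add b
      exact h1.eventually (gt_mem_nhds one_pos)
    have htail := (tendsto_add_atTop_iff_nat N).2 h.push.tail_tendsto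
    obtain ⟨m, hm1, hm2⟩ := (hev.and (htail.eventually (gt_mem_nhds one_pos))).exists
    have hz : ‖((8:ℂ)^(m+N)) • ((A^(m+N)) y - p)‖ + 1 ≤ 2^(m+N) := by
      rw [norm_smul, pow_add A, Equiv.Perm.mul_apply, ← dist_eq_norm]
      have h1 := h.contr_pow hN m
      have h8 : ‖(8:ℂ)^(m+N)‖ = 8^m * 8^N := by simp [pow_add]
      rw [h8]
      have h2 : dist ((A^m) ((A^N) y)) p ≤ (3/16)^m * r :=
        h1.trans (by have := (mem_ball.1 hN).le; gcongr)
      have h3 : (8:ℝ)^m * 8^N * dist ((A^m) ((A^N) y)) p ≤ 8^m * 8^N * ((3/16)^m * r) := by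
        gcongr
      have e1 : (8:ℝ)^m * (3/16)^m = 2^m * (3/4)^m := by
        rw [← mul_pow, ← mul_pow]; norm_num
      have e2 : (2:ℝ)^m * (1/2)^m = 1 := by rw [← mul_pow]; norm_num
      have e3 : (8:ℝ)^m * 8^N * ((3/16)^m * r) + 1
          = 2^m * ((8:ℝ)^N * r * (3/4)^m + (1/2)^m) := by
        linear_combination (8^N * r) * e1 - e2
      have h4 : (2:ℝ)^m * ((8:ℝ)^N * r * (3/4)^m + (1/2)^m) ≤ 2^m * 1 := by gcongr
      have h5 : (2:ℝ)^m ≤ 2^(m+N) := pow_le_pow_right₀ (by norm_num) (by omega)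
      linarith
    have c1 : ((8:ℂ)^(m+N)) • ((A^(m+N)) y - p) ∈ closedBall (0:E) (2^(m+N)) := by
      rw [mem_closedBall, dist_zero_right]; linarith
    have c2 : ∀ j > m + N, closedBall (((8:ℂ)^(m+N)) • ((A^(m+N)) y - p)) 1
        ⊆ closedBall (0:E) (2^j) := by
      intro j hj
      apply closedBall_subset_closedBall'
      rw [dist_zero_right]
      have : (2:ℝ)^(m+N) ≤ 2^j := pow_le_pow_right₀ (by norm_num) hj.le
      linarith
    obtain ⟨z, -, hzq⟩ := hGc y (m+N) 1 c1 c2 (subset_univ _) hm2.le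
    exact ⟨z, hzq⟩

theorem basin_open {A : Equiv.Perm E} (hA : IsAut A) (p : E) (r : ℝ) : IsOpen (basin A p r) := by
  have : basin A p r = ⋃ n : ℕ, (fun y => (A^n) y) ⁻¹' ball p r := by
    ext; simp [basin]
  rw [this]
  exact isOpen_iUnion fun n => isOpen_ball.preimage (hA.pow n).1.continuous

theorem AttrData.basin_tendsto {A : Equiv.Perm E} {p : E} {C r : ℝ}
    (h : AttrData A p C r) {y : E} (hy : y ∈ basin A p r) :
    Tendsto (fun n => (A^n) y) atTop (𝓝 p) := by
  obtain ⟨N, hN⟩ := hy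
  rw [← tendsto_add_atTop_iff_nat N, tendsto_iff_dist_tendsto_zero]
  have a := (tendsto_pow_atTop_nhds_zero_of_lt_one (r := (3/16:ℝ)) (by norm_num)
          (by norm_num)).mul_const (dist ((A^N) y) p)
  rw [zero_mul] at a
  refine squeeze_zero (fun _ => dist_nonneg) (fun m => ?_) a
  rw [pow_add A, Equiv.Perm.mul_apply]
  exact h.contr_pow hN m

end basin

section construct
open scoped Topology

section sh
variable {E : Type*} [NormedAddCommGroup E] [NormedSpace ℂ E]

/-- the shear `z ↦ z + f (α z) • v` with `α v = 0` -/
def shear (α : E →L[ℂ] ℂ) (v : E) (hv : α v = 0) (f : ℂ → ℂ) : Equiv.Perm E where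
  toFun z := z + f (α z) • v
  invFun z := z - f (α z) • v
  left_inv z := by simp [hv]
  right_inv z := by simp [hv]

theorem shear_apply (α : E →L[ℂ] ℂ) (v : E) (hv : α v = 0) (f : ℂ → ℂ) (z : E) :
    shear α v hv f z = z + f (α z) • v := rfl

theorem shear_inv_apply (α : E →L[ℂ] ℂ) (v : E) (hv : α v = 0) (f : ℂ → ℂ) (z : E) :
    (shear α v hv f)⁻¹ z = z - f (α z) • v := rfl

theorem shear_aut (α : E →L[ℂ] ℂ) (v : E) (hv : α v = 0) {f : ℂ → ℂ} (hf : Differentiable ℂ f) :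
    IsAut (shear α v hv f) := by
  constructor
  · exact differentiable_id.add ((hf.comp α.differentiable).smul_const v)
  · exact differentiable_id.sub ((hf.comp α.differentiable).smul_const v)

theorem shear_deriv (α : E →L[ℂ] ℂ) (v : E) (hv : α v = 0) {f : ℂ → ℂ} {p : E}
    (hf : HasDerivAt f 0 (α p)) :
    HasFDerivAt (shear α v hv f) (ContinuousLinearMap.id ℂ E) p := by
  have h1 : HasFDerivAt (fun z => f (α z)) ((0:ℂ) • α) p := hf.comp_hasFDerivAt p α.hasFDerivAt
  have h2 := (hasFDerivAt_id (𝕜 := ℂ) p).add (h1.smul_const v)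
  refine h2.congr_fderiv ?_
  ext; simp

theorem shear_inv_deriv (α : E →L[ℂ] ℂ) (v : E) (hv : α v = 0) {f : ℂ → ℂ} {p : E}
    (hf : HasDerivAt f 0 (α p)) :
    HasFDerivAt ((shear α v hv f)⁻¹ : Equiv.Perm E) (ContinuousLinearMap.id ℂ E) p := by
  have h1 : HasFDerivAt (fun z => f (α z)) ((0:ℂ) • α) p := hf.comp_hasFDerivAt p α.hasFDerivAt
  have h2 := (hasFDerivAt_id (𝕜 := ℂ) p).sub (h1.smul_const v)
  refine h2.congr_fderiv ?_
  ext; simp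

theorem chart0_deriv (q : E) :
    HasFDerivAt (chart (0:E) 1) ((1/8 : ℂ) • ContinuousLinearMap.id ℂ E) q := by
  have h := (hasFDerivAt_id (𝕜 := ℂ) q).const_smul (1/8 : ℂ)
  exact h.congr_of_eventuallyEq (Eventually.of_forall fun z => by simp [chart_apply])

theorem chart0_inv_deriv (q : E) :
    HasFDerivAt ((chart (0:E) 1)⁻¹ : Equiv.Perm E) ((8 : ℂ) • ContinuousLinearMap.id ℂ E) q := by
  have h := (hasFDerivAt_id (𝕜 := ℂ) q).const_smul (8 : ℂ)
  exact h.congr_of_eventuallyEq (Eventually.of_forall fun z => by simp [chart_inv_apply])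
end sh

/-- a function interpolating the integers with vanishing derivative there -/
def uu (z : ℂ) : ℂ := z - Complex.sin (2 * Real.pi * z) / (2 * Real.pi)

theorem uu_diff : Differentiable ℂ uu := by
  unfold uu; fun_prop

theorem uu_nat (l : ℕ) : uu l = l := by
  have : Complex.sin (2 * Real.pi * l) = 0 := by
    rw [Complex.sin_eq_zero_iff]; exact ⟨2 * l, by push_cast; ring⟩
  simp [uu, this]

theorem uu_deriv (l : ℕ) : HasDerivAt uu 0 (l : ℂ) := by
  have h1 : HasDerivAt (fun z : ℂ => 2 * Real.pi * z) (2 * Real.pi * 1) (l : ℂ) :=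
    (hasDerivAt_id _).const_mul (2 * Real.pi : ℂ)
  have h2 := (hasDerivAt_id (l : ℂ)).sub ((h1.csin).div_const (2 * Real.pi))
  have hc : Complex.cos (2 * Real.pi * l) = 1 := by
    rw [Complex.cos_eq_one_iff]; exact ⟨l, by push_cast; ring⟩
  refine h2.congr_deriv ?_
  have : (Real.pi : ℂ) ≠ 0 := by exact_mod_cast Real.pi_ne_zero
  rw [hc]; field_simp; simp

variable {k : ℕ}

theorem exists_attr (hk : 2 ≤ k) (m : ℕ) :
    ∃ (A : Equiv.Perm (EuclideanSpace ℂ (Fin k))) (p : Fin (m+1) → EuclideanSpace ℂ (Fin k))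
      (C r : ℝ), Function.Injective p ∧ ∀ l, AttrData A (p l) C r := by
  let i0 : Fin k := ⟨0, by omega⟩
  let i1 : Fin k := ⟨1, by omega⟩
  have h01 : i0 ≠ i1 := by simp [i0, i1]
  let e0 : EuclideanSpace ℂ (Fin k) := EuclideanSpace.single i0 1
  let e1 : EuclideanSpace ℂ (Fin k) := EuclideanSpace.single i1 1
  let π0 : EuclideanSpace ℂ (Fin k) →L[ℂ] ℂ := EuclideanSpace.proj i0
  let π1 : EuclideanSpace ℂ (Fin k) →L[ℂ] ℂ := EuclideanSpace.proj i1
  have h00 : π0 e0 = 1 := by simp [π0, e0]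
  have h11 : π1 e1 = 1 := by simp [π1, e1]
  have h10 : π1 e0 = 0 := by simp [π1, e0, h01.symm]
  have h01' : π0 e1 = 0 := by simp [π0, e1, h01]
  let f1 : ℂ → ℂ := fun z => (7/8) * uu (8 * z)
  let f2 : ℂ → ℂ := fun z => (7/8) * uu z
  have hf1 : Differentiable ℂ f1 :=
    (uu_diff.comp (differentiable_id.const_mul (8:ℂ))).const_mul _
  have hf2 : Differentiable ℂ f2 := uu_diff.const_mul _
  let S1 := shear π1 e0 h10 f1
  let S2 := shear π0 e1 h01' f2
  let sc : Equiv.Perm (EuclideanSpace ℂ (Fin k)) := chart 0 1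
  let A := S2 * (S1 * sc)
  have hA : IsAut A := (shear_aut _ _ _ hf2).mul ((shear_aut _ _ _ hf1).mul (chart_aut _ _))
  let p : Fin (m+1) → EuclideanSpace ℂ (Fin k) := fun l => ((l : ℕ) : ℂ) • (e0 + e1)
  let q1 : Fin (m+1) → EuclideanSpace ℂ (Fin k) := fun l => (((l : ℕ) : ℂ)/8) • (e0 + e1)
  let q2 : Fin (m+1) → EuclideanSpace ℂ (Fin k) :=
    fun l => ((l : ℕ) : ℂ) • e0 + (((l : ℕ) : ℂ)/8) • e1
  have t1 : ∀ l, sc (p l) = q1 l := by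
    intro l; simp only [sc, chart_apply, p, q1, zero_add, pow_one, smul_smul]; congr 1; ring
  have hf1l : ∀ l : Fin (m+1), f1 (π1 (q1 l)) = 7/8 * ((l:ℕ):ℂ) := by
    intro l
    have : π1 (q1 l) = ((l : ℕ) : ℂ)/8 := by simp [q1, h10, h11]
    simp only [f1, this]
    rw [mul_div_cancel₀ _ (by norm_num : (8:ℂ) ≠ 0), uu_nat]
  have hf2l : ∀ l : Fin (m+1), f2 (π0 (q2 l)) = 7/8 * ((l:ℕ):ℂ) := by
    intro l
    have : π0 (q2 l) = ((l : ℕ) : ℂ) := by simp [q2, h00, h01']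
    simp only [f2, this]
    rw [uu_nat]
  have t2 : ∀ l, S1 (q1 l) = q2 l := by
    intro l
    simp only [S1, shear_apply, hf1l]
    simp only [q1, q2]; module
  have t3 : ∀ l, S2 (q2 l) = p l := by
    intro l
    simp only [S2, shear_apply, hf2l]
    simp only [p, q2]; module
  have tA : ∀ l, A (p l) = p l := by
    intro l; simp only [A, Equiv.Perm.mul_apply, t1, t2, t3]
  have d1 : ∀ l : Fin (m+1), HasDerivAt f1 0 (π1 (q1 l)) := by
    intro l
    have e : π1 (q1 l) = ((l : ℕ) : ℂ)/8 := by simp [q1, h10, h11]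
    have a : HasDerivAt uu 0 (8 * π1 (q1 l)) := by
      rw [e, mul_div_cancel₀ _ (by norm_num : (8:ℂ) ≠ 0)]; exact uu_deriv l
    have b := (a.comp (π1 (q1 l)) ((hasDerivAt_id _).const_mul (8:ℂ))).const_mul (7/8 : ℂ)
    simpa using b
  have d2 : ∀ l : Fin (m+1), HasDerivAt f2 0 (π0 (q2 l)) := by
    intro l
    have e : π0 (q2 l) = ((l : ℕ) : ℂ) := by simp [q2, h00, h01']
    rw [e]
    simpa using (uu_deriv l).const_mul (7/8 : ℂ)
  have d1' : ∀ l : Fin (m+1), HasDerivAt f1 0 (π1 (q2 l)) := by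
    intro l
    have e : π1 (q2 l) = π1 (q1 l) := by simp [q1, q2, h10, h11]
    rw [e]; exact d1 l
  have d2' : ∀ l : Fin (m+1), HasDerivAt f2 0 (π0 (p l)) := by
    intro l
    have e : π0 (p l) = π0 (q2 l) := by simp [p, q2, h00, h01']
    rw [e]; exact d2 l
  have fd : ∀ l, HasFDerivAt A ((1/8 : ℂ) • ContinuousLinearMap.id ℂ _) (p l) := by
    intro l
    have a0 : HasFDerivAt sc ((1/8 : ℂ) • ContinuousLinearMap.id ℂ _) (p l) :=
      chart0_deriv _
    have a1 : HasFDerivAt S1 (ContinuousLinearMap.id ℂ _) (sc (p l)) := by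
      rw [t1]; exact shear_deriv _ _ _ (d1 l)
    have a2 : HasFDerivAt S2 (ContinuousLinearMap.id ℂ _) ((S1 ∘ sc) (p l)) := by
      rw [Function.comp, t1, t2]; exact shear_deriv _ _ _ (d2 l)
    have := a2.comp (p l) (a1.comp (p l) a0)
    exact this.congr_fderiv (by ext; simp)
  have fdi : ∀ l, HasFDerivAt (A⁻¹ : Equiv.Perm _)
      ((8 : ℂ) • ContinuousLinearMap.id ℂ _) (p l) := by
    intro l
    have u3 : S2⁻¹ (p l) = q2 l := by rw [Equiv.Perm.inv_eq_iff_eq, t3]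
    have u2 : S1⁻¹ (q2 l) = q1 l := by rw [Equiv.Perm.inv_eq_iff_eq, t2]
    have a0 : HasFDerivAt (sc⁻¹ : Equiv.Perm _) ((8 : ℂ) • ContinuousLinearMap.id ℂ _)
        (((S1⁻¹ : Equiv.Perm _) ∘ (S2⁻¹ : Equiv.Perm _)) (p l)) :=
      chart0_inv_deriv _
    have a1 : HasFDerivAt (S1⁻¹ : Equiv.Perm _) (ContinuousLinearMap.id ℂ _) (S2⁻¹ (p l)) := by
      rw [u3]; exact shear_inv_deriv _ _ _ (d1' l)
    have a2 : HasFDerivAt (S2⁻¹ : Equiv.Perm _) (ContinuousLinearMap.id ℂ _) (p l) :=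
      shear_inv_deriv _ _ _ (d2' l)
    have := a0.comp (p l) (a1.comp (p l) a2)
    have e : ((A⁻¹ : Equiv.Perm _) : EuclideanSpace ℂ (Fin k) → _) =
      (sc⁻¹ : Equiv.Perm _) ∘ (S1⁻¹ : Equiv.Perm _) ∘ (S2⁻¹ : Equiv.Perm _) := by
      funext z; simp only [A, mul_inv_rev, Equiv.Perm.mul_apply, Function.comp]
    rw [e]
    exact this.congr_fderiv (by ext; simp)
  have tAi : ∀ l, A⁻¹ (p l) = p l := by
    intro l; rw [Equiv.Perm.inv_eq_iff_eq, tA]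
  choose C1 hC1 hC1' using fun l => second_order hA.1 (tA l) (fd l)
  choose C2 hC2 hC2' using fun l => second_order hA.2 (tAi l) (fdi l)
  let C := ∑ l, C1 l + ∑ l, C2 l
  have s1 : ∀ l, C1 l ≤ ∑ l, C1 l := fun l =>
    Finset.single_le_sum (fun i _ => hC1 i) (Finset.mem_univ l)
  have s2 : ∀ l, C2 l ≤ ∑ l, C2 l := fun l =>
    Finset.single_le_sum (fun i _ => hC2 i) (Finset.mem_univ l)
  have b1 : ∀ l, C1 l ≤ C := fun l => by
    have := (hC2 0).trans (s2 0); have := s1 l; simp only [C]; linarith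
  have b2 : ∀ l, C2 l ≤ C := fun l => by
    have := (hC1 0).trans (s1 0); have := s2 l; simp only [C]; linarith
  have hC : 0 ≤ C := (hC1 0).trans (b1 0)
  refine ⟨A, p, C, 1 / (16 * (C + 1)), ?_, fun l => ?_⟩
  · intro a b hab
    have := congrArg π0 hab
    simp only [p, map_smul, map_add, h00, h01', add_zero, smul_eq_mul, mul_one] at this
    exact Fin.ext (by exact_mod_cast this)
  · refine ⟨hA, hC, by positivity, ?_, ?_, ?_, ?_⟩
    · rw [div_le_one (by positivity)]; linarith
    · rw [mul_one_div, div_le_iff₀ (by positivity)]; linarith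
    · intro h hh
      exact (hC1' l h hh).trans (by have := b1 l; gcongr)
    · intro h hh
      exact (hC2' l h hh).trans (by have := b2 l; gcongr)

end construct

section generalpos
open scoped Topology

variable {E : Type*} [NormedAddCommGroup E] [NormedSpace ℂ E]

theorem gp_fin (n : ℕ) : ∃ c : ℝ, 0 < c ∧ c ≤ 1 ∧ ∀ u : Fin n → E, (∀ l, ‖u l‖ = 1) →
    ∃ α : E →L[ℂ] ℂ, ‖α‖ ≤ 1 ∧ ∀ l, c ≤ ‖α (u l)‖ := by
  induction n with
  | zero => exact ⟨1, one_pos, le_rfl, fun u _ => ⟨0, by simp, fun l => l.elim0⟩⟩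
  | succ n ih =>
    obtain ⟨c, hc, hc1, H⟩ := ih
    refine ⟨c/8, by positivity, by linarith, fun u hu => ?_⟩
    obtain ⟨α, hα, hαu⟩ := H (fun l => u l.castSucc) (fun l => hu _)
    by_cases hlast : c/4 ≤ ‖α (u (Fin.last n))‖
    · refine ⟨α, hα, fun l => ?_⟩
      refine Fin.lastCases ?_ (fun i => ?_) l
      · linarith
      · have := hαu i; linarith
    · push Not at hlast
      have hne : u (Fin.last n) ≠ 0 := by
        intro h; have := hu (Fin.last n); rw [h, norm_zero] at this; norm_num at this
      obtain ⟨β, hβ, hβu⟩ := exists_dual_vector ℂ (u (Fin.last n)) (norm_ne_zero_iff.2 hne)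
      rw [hu] at hβu
      have hβu' : β (u (Fin.last n)) = 1 := by simpa using hβu
      have n2 : ‖(1/2 : ℂ)‖ = 1/2 := by norm_num
      have nc : ‖((c/2 : ℝ) : ℂ)‖ = c/2 := by
        rw [Complex.norm_real, Real.norm_of_nonneg (by positivity)]
      refine ⟨(1/2 : ℂ) • (α + ((c/2 : ℝ) : ℂ) • β), ?_, fun l => ?_⟩
      · rw [norm_smul, n2]
        have : ‖α + ((c/2 : ℝ) : ℂ) • β‖ ≤ ‖α‖ + c/2 := by
          refine (norm_add_le _ _).trans ?_
          rw [norm_smul, nc, hβ, mul_one]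
        linarith
      · have e : ‖((1/2 : ℂ) • (α + ((c/2 : ℝ) : ℂ) • β)) (u l)‖
            = 1/2 * ‖α (u l) + ((c/2 : ℝ) : ℂ) * β (u l)‖ := by
          rw [smul_apply, norm_smul, n2]; rfl
        rw [e]
        revert e
        refine Fin.lastCases ?_ (fun i => ?_) l
        · intro _
          rw [hβu', mul_one]
          have := norm_sub_le_norm_add (((c/2 : ℝ) : ℂ)) (α (u (Fin.last n)))
          rw [nc, add_comm] at this
          linarith
        · intro _
          have h1 := norm_sub_le_norm_add (α (u i.castSucc)) (((c/2 : ℝ) : ℂ) * β (u i.castSucc))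
          have h2 : ‖((c/2 : ℝ) : ℂ) * β (u i.castSucc)‖ ≤ c/2 := by
            rw [norm_mul, nc]
            have := β.le_opNorm (u i.castSucc)
            rw [hβ, hu, one_mul] at this
            nlinarith
          have h3 := hαu i
          linarith

/-- general position functionals -/
theorem gp (ι : Type*) [Fintype ι] : ∃ c : ℝ, 0 < c ∧ ∀ u : ι → E, (∀ l, u l ≠ 0) →
    ∃ α : E →L[ℂ] ℂ, ‖α‖ ≤ 1 ∧ ∀ l, c * ‖u l‖ ≤ ‖α (u l)‖ := by
  obtain ⟨c, hc, -, H⟩ := gp_fin (E := E) (Fintype.card ι)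
  refine ⟨c, hc, fun u hu => ?_⟩
  let e := Fintype.equivFin ι
  obtain ⟨α, hα, h⟩ := H (fun j => ((‖u (e.symm j)‖⁻¹ : ℝ) : ℂ) • u (e.symm j)) (fun j => by
    rw [norm_smul, Complex.norm_real, norm_inv, norm_norm,
      inv_mul_cancel₀ (norm_ne_zero_iff.2 (hu _))])
  refine ⟨α, hα, fun l => ?_⟩
  have := h (e l)
  rw [Equiv.symm_apply_apply, map_smul, norm_smul, Complex.norm_real, norm_inv, norm_norm,
    inv_mul_eq_div, le_div_iff₀ (norm_pos_iff.2 (hu _))] at this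
  exact this

theorem shear_lemma {ι : Type*} [Fintype ι] (p : ι → E) (p0 : E) {c : ℝ} (hc : 0 < c) :
    ∃ ρ : ℝ, 0 < ρ ∧ ∀ (y : E) (α : E →L[ℂ] ℂ), ‖α‖ ≤ 1 → (∀ l, c ≤ ‖α (y - p l)‖) →
      α y ≠ α p0 → ∀ v, α v = 0 → ∀ κ > 0, ∃ σ : Equiv.Perm E, IsAut σ ∧ σ y = y + v ∧
        σ p0 = p0 ∧ ∀ l, ∀ z ∈ closedBall (p l) ρ, dist (σ z) z ≤ κ ∧ dist (σ⁻¹ z) z ≤ κ := by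
  classical
  let S : ℝ := ∑ j, ∑ l, ‖p j - p l‖
  have hS0 : 0 ≤ S := Finset.sum_nonneg fun _ _ => Finset.sum_nonneg fun _ _ => norm_nonneg _
  have hS : ∀ j l, ‖p j - p l‖ ≤ S := fun j l =>
    (Finset.single_le_sum (f := fun l => ‖p j - p l‖) (fun i _ => norm_nonneg _)
      (Finset.mem_univ l)).trans
    (Finset.single_le_sum (f := fun j => ∑ l, ‖p j - p l‖)
      (fun i _ => Finset.sum_nonneg fun _ _ => norm_nonneg _) (Finset.mem_univ j))
  let T : ℝ := ∑ j, ‖p j - p0‖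
  have hT0 : 0 ≤ T := Finset.sum_nonneg fun _ _ => norm_nonneg _
  have hT : ∀ j, ‖p j - p0‖ ≤ T := fun j =>
    Finset.single_le_sum (f := fun j => ‖p j - p0‖) (fun i _ => norm_nonneg _) (Finset.mem_univ j)
  let D : ℝ := (S + 1) / c + 1
  have hD0 : 0 ≤ (S + 1) / c := by positivity
  have hD1 : 1 ≤ D := by simp only [D]; linarith
  let n := Fintype.card ι
  let ρ : ℝ := min 1 (c / (2 * D ^ n))
  have hDn : 0 < D ^ n := by positivity
  have hρ : 0 < ρ := by simp only [ρ]; positivity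
  have hρ1 : ρ ≤ 1 := min_le_left _ _
  have hρ2 : ρ / c * D ^ n ≤ 1/2 := by
    have : ρ ≤ c / (2 * D ^ n) := min_le_right _ _
    rw [le_div_iff₀ (by positivity)] at this
    rw [div_mul_eq_mul_div, div_le_iff₀ hc]; linarith
  refine ⟨ρ, hρ, fun y α hα hy hy0 v hv κ hκ => ?_⟩
  have hα' : ∀ z, ‖α z‖ ≤ ‖z‖ := fun z =>
    (α.le_opNorm z).trans (mul_le_of_le_one_left (norm_nonneg _) hα)
  have hyl : ∀ l, α y - α (p l) ≠ 0 := fun l => by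
    rw [← map_sub]; exact norm_pos_iff.1 (hc.trans_le (hy l))
  have hy0' : α y - α p0 ≠ 0 := sub_ne_zero.2 hy0
  let P : ℂ → ℂ := fun η => ∏ l, (η - α (p l)) / (α y - α (p l))
  have hPd : Differentiable ℂ P := by
    have : Differentiable ℂ (fun η => ∏ l ∈ Finset.univ, (η - α (p l)) / (α y - α (p l))) :=
      Differentiable.fun_finsetProd fun l _ => (differentiable_id.sub_const _).div_const _
    exact this
  have hPy : P (α y) = 1 := by
    simp only [P]; exact Finset.prod_eq_one fun l _ => div_self (hyl l)
  have hP : ∀ j, ∀ z ∈ closedBall (p j) ρ, ‖P (α z)‖ ≤ 1/2 := by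
    intro j z hz
    rw [mem_closedBall, dist_eq_norm] at hz
    have hfac : ∀ l, ‖(α z - α (p l)) / (α y - α (p l))‖ ≤ ‖z - p l‖ / c := by
      intro l
      rw [norm_div, ← map_sub, ← map_sub]
      exact div_le_div₀ (norm_nonneg _) (hα' _) hc (hy l)
    simp only [P]
    rw [← Finset.mul_prod_erase _ _ (Finset.mem_univ j), norm_mul, norm_prod]
    have h1 : ‖(α z - α (p j)) / (α y - α (p j))‖ ≤ ρ / c := (hfac j).trans (by gcongr)
    have h2 : ∏ l ∈ Finset.univ.erase j, ‖(α z - α (p l)) / (α y - α (p l))‖ ≤ D ^ n := by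
      have hle : ∀ l, ‖(α z - α (p l)) / (α y - α (p l))‖ ≤ D := by
        intro l
        have h3 : ‖z - p l‖ ≤ S + 1 := by
          have : z - p l = (z - p j) + (p j - p l) := by abel
          rw [this]
          refine (norm_add_le _ _).trans ?_
          have := hS j l
          linarith
        have h4 : ‖z - p l‖ / c ≤ (S + 1) / c := by gcongr
        have := hfac l
        simp only [D]; linarith
      refine (Finset.prod_le_prod (fun _ _ => norm_nonneg _) (fun l _ => hle l)).trans ?_
      rw [Finset.prod_const]
      exact pow_le_pow_right₀ hD1 (Finset.card_le_univ _)
    calc _ ≤ ρ / c * D ^ n := by gcongr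
      _ ≤ 1/2 := hρ2
  let R : ℝ := (T + 1) / ‖α y - α p0‖ * ‖v‖
  have hR0 : 0 ≤ R := by simp only [R]; positivity
  obtain ⟨e, he⟩ := exists_pow_lt_of_lt_one (show (0:ℝ) < κ / (R + 1) by positivity)
    (by norm_num : (1/2 : ℝ) < 1)
  let f : ℂ → ℂ := fun η => P η ^ e * ((η - α p0) / (α y - α p0))
  have hf : Differentiable ℂ f :=
    (hPd.pow e).mul ((differentiable_id.sub_const _).div_const _)
  have hfb : ∀ l, ∀ z ∈ closedBall (p l) ρ, ‖f (α z) • v‖ ≤ κ := by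
    intro l z hz
    have h1 : ‖P (α z) ^ e‖ ≤ (1/2) ^ e := by
      rw [norm_pow]; have := hP l z hz; gcongr
    have h2 : ‖(α z - α p0) / (α y - α p0)‖ ≤ (T + 1) / ‖α y - α p0‖ := by
      rw [norm_div]
      gcongr
      rw [← map_sub]
      refine (hα' _).trans ?_
      have : z - p0 = (z - p l) + (p l - p0) := by abel
      rw [this]
      refine (norm_add_le _ _).trans ?_
      rw [mem_closedBall, dist_eq_norm] at hz
      have := hT l
      linarith
    rw [norm_smul, norm_mul]
    calc _ ≤ (1/2)^e * ((T + 1) / ‖α y - α p0‖) * ‖v‖ := by gcongr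
      _ = (1/2)^e * R := by simp only [R]; ring
      _ ≤ κ / (R+1) * (R + 1) := by gcongr; linarith
      _ = κ := by field_simp
  refine ⟨shear α v hv f, shear_aut _ _ _ hf, ?_, ?_, fun l z hz => ⟨?_, ?_⟩⟩
  · rw [shear_apply]; simp only [f, hPy, div_self hy0', one_pow, one_mul, one_smul]
  · rw [shear_apply]; simp [f]
  · rw [shear_apply, dist_eq_norm, add_sub_cancel_left]; exact hfb l z hz
  · rw [shear_inv_apply, dist_eq_norm, sub_sub_cancel_left, norm_neg]; exact hfb l z hz

end generalpos

section propP
open scoped Topology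

variable {E : Type*} [NormedAddCommGroup E] [NormedSpace ℂ E]

theorem AttrData.fix {A : Equiv.Perm E} {p : E} {C r : ℝ} (h : AttrData A p C r) : A p = p := by
  have := h.contr (z := p) (by simpa using h.hr)
  rw [dist_self, mul_zero] at this
  exact dist_le_zero.1 this

theorem AttrData.fix_pow {A : Equiv.Perm E} {p : E} {C r : ℝ} (h : AttrData A p C r) (n : ℕ) :
    (A^n) p = p := by
  have := h.contr_pow (z := p) (by simpa using h.hr) n
  rw [dist_self, mul_zero] at this
  exact dist_le_zero.1 this

theorem AttrData.ball_inv {A : Equiv.Perm E} {p : E} {C r ρ : ℝ} (h : AttrData A p C r)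
    (hρ : ρ ≤ r) {z : E} (hz : z ∈ ball p ρ) (n : ℕ) : (A^n) z ∈ ball p ρ := by
  have h1 := h.contr_pow (lt_of_lt_of_le hz hρ) n
  refine lt_of_le_of_lt (h1.trans ?_) hz
  exact mul_le_of_le_one_left dist_nonneg (pow_le_one₀ (by norm_num) (by norm_num))

theorem AttrData.ball_subset {A : Equiv.Perm E} {p : E} {r : ℝ} : ball p r ⊆ basin A p r :=
  fun _ hz => ⟨0, by simpa using hz⟩

theorem AttrData.disj {A : Equiv.Perm E} {p q : E} {C r C' r' : ℝ} (h : AttrData A p C r)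
    (h' : AttrData A q C' r') (hpq : p ≠ q) {z : E} (hz : z ∈ basin A p r)
    (hz' : z ∈ basin A q r') : False :=
  hpq (tendsto_nhds_unique (h.basin_tendsto hz) (h'.basin_tendsto hz'))

theorem exists_pos_le {ι : Type*} [Finite ι] [Nonempty ι] (f : ι → ℝ) (hf : ∀ i, 0 < f i) :
    ∃ c > 0, ∀ i, c ≤ f i := by
  obtain ⟨i, hi⟩ := Finite.exists_min f
  exact ⟨f i, hf i, hi⟩

/-- Standing data. -/
structure Setup (A : Equiv.Perm E) (p0 : E) {m : ℕ} (p : Fin m → E) (C r : ℝ) : Prop where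
  h0 : AttrData A p0 C r
  h : ∀ l, AttrData A (p l) C r
  inj : Function.Injective p
  ne0 : ∀ l, p l ≠ p0
  ker : ∀ β : E →L[ℂ] ℂ, ∃ w, w ≠ 0 ∧ β w = 0

/-- union of the basins -/
def WW (A : Equiv.Perm E) {m : ℕ} (p : Fin m → E) (r : ℝ) : Set E := ⋃ l, basin A (p l) r

variable {A : Equiv.Perm E} {p0 : E} {m : ℕ} {p : Fin m → E} {C r : ℝ}

theorem Setup.absorb (S : Setup A p0 p C r) {L : Set E} (hL : IsCompact L) (hLW : L ⊆ WW A p r)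
    {ρ : ℝ} (hρ : 0 < ρ) : ∃ M : ℕ, ∀ z ∈ L, ∃ l, (A^M) z ∈ ball (p l) ρ := by
  have hr : 0 < r := S.h0.hr
  let ρ' := min ρ r
  have hρ' : 0 < ρ' := lt_min hρ hr
  let U : ℕ → Set E := fun n => ⋃ l, (fun z => (A^n) z) ⁻¹' ball (p l) ρ'
  have hU : ∀ n, IsOpen (U n) := fun n => isOpen_iUnion fun l =>
    isOpen_ball.preimage (S.h0.aut.pow n).1.continuous
  have hmono : Monotone U := by
    intro a b hab z hz
    obtain ⟨l, hl⟩ := mem_iUnion.1 hz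
    refine mem_iUnion.2 ⟨l, ?_⟩
    have := (S.h l).ball_inv (min_le_right ρ r) hl (b - a)
    rw [← Equiv.Perm.mul_apply, ← pow_add, Nat.sub_add_cancel hab] at this
    exact this
  obtain ⟨M, hM⟩ := hL.elim_directed_cover U hU (by
    intro z hz
    obtain ⟨l, hl⟩ := mem_iUnion.1 (hLW hz)
    have := ((S.h l).basin_tendsto hl).eventually (ball_mem_nhds _ hρ')
    obtain ⟨n, hn⟩ := this.exists
    exact mem_iUnion.2 ⟨n, mem_iUnion.2 ⟨l, hn⟩⟩) (hmono.directed_le)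
  refine ⟨M, fun z hz => ?_⟩
  obtain ⟨l, hl⟩ := mem_iUnion.1 (hM hz)
  exact ⟨l, ball_subset_ball (min_le_left _ _) hl⟩

theorem Setup.propP [ProperSpace E] (S : Setup A p0 p C r) {L : Set E} (hL : IsCompact L)
    (hLW : L ⊆ WW A p r) {ε : ℝ} (hε : 0 < ε) {y : E} (hy : y ∉ WW A p r) (hy0 : y ≠ p0)
    (i : Fin m) : ∃ θ : Equiv.Perm E, IsAut θ ∧ θ p0 = p0 ∧ θ y ∈ basin A (p i) r ∧
      ∀ z ∈ L, dist (θ z) z ≤ ε ∧ dist (θ⁻¹ z) z ≤ ε := by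
  have hr : 0 < r := S.h0.hr
  -- the target point
  obtain ⟨s, hs, hsi⟩ : ∃ s ∈ ball (p i) r, s ≠ p i := by
    obtain ⟨w, hw, -⟩ := S.ker 0
    have hw' : 0 < ‖w‖ := norm_pos_iff.2 hw
    have hn : ‖((r / 2 / ‖w‖ : ℝ) : ℂ) • w‖ = r / 2 := by
      rw [norm_smul, Complex.norm_real, Real.norm_of_nonneg (by positivity)]
      field_simp
    refine ⟨p i + ((r / 2 / ‖w‖ : ℝ) : ℂ) • w, ?_, ?_⟩
    · rw [mem_ball, dist_eq_norm, add_sub_cancel_left, hn]; linarith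
    · intro h
      rw [add_eq_left] at h
      rw [h, norm_zero] at hn
      linarith
  have hsp : ∀ l, s ≠ p l := by
    intro l hl
    by_cases hli : l = i
    · exact hsi (hli ▸ hl)
    · have h1 : s ∈ basin A (p i) r := AttrData.ball_subset hs
      have h2 : s ∈ basin A (p l) r := by
        rw [hl]; exact AttrData.ball_subset (mem_ball_self hr)
      exact (S.h i).disj (S.h l) (fun e => hli (S.inj e).symm) h1 h2
  have hs0 : s ≠ p0 := by
    intro hl
    have h1 : s ∈ basin A (p i) r := AttrData.ball_subset hs
    have h2 : s ∈ basin A p0 r := by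
      rw [hl]; exact AttrData.ball_subset (mem_ball_self hr)
    exact (S.h i).disj S.h0 (S.ne0 i) h1 h2
  -- the functional β
  obtain ⟨c1, hc1, H1⟩ := gp (E := E) (Option (Fin m))
  obtain ⟨β, hβ, hβs⟩ := H1 (fun o => o.elim (s - p0) (fun l => s - p l)) (by
    intro o; cases o with
    | none => exact sub_ne_zero.2 hs0
    | some l => exact sub_ne_zero.2 (hsp l))
  have hβ0 : 0 < ‖β (s - p0)‖ :=
    lt_of_lt_of_le (mul_pos hc1 (norm_pos_iff.2 (sub_ne_zero.2 hs0))) (hβs none)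
  have hβl : ∀ l, 0 < ‖β (s - p l)‖ := fun l =>
    lt_of_lt_of_le (mul_pos hc1 (norm_pos_iff.2 (sub_ne_zero.2 (hsp l)))) (hβs (some l))
  haveI : Nonempty (Fin m) := ⟨i⟩
  obtain ⟨cβ, hcβ, hcβl⟩ := exists_pos_le _ hβl
  obtain ⟨w0, hw0, hβw0⟩ := S.ker β
  obtain ⟨c2, hc2, H2⟩ := gp (E := E) (Option (Option (Fin m)))
  obtain ⟨ρ, hρ, SH⟩ := shear_lemma p p0 (c := min (c2 * r) cβ) (by positivity)
  obtain ⟨M, hM⟩ := S.absorb hL hLW (half_pos hρ)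
  -- the moved point
  set y' := (A^M) y with hy'
  have hy'0 : y' ≠ p0 := by
    intro h
    rw [← S.h0.fix_pow M] at h
    exact hy0 ((A^M).injective h)
  have hy'l : ∀ l, r ≤ ‖y' - p l‖ := by
    intro l
    by_contra hlt
    push Not at hlt
    exact hy (mem_iUnion.2 ⟨l, M, by rw [mem_ball, dist_eq_norm]; exact hlt⟩)
  obtain ⟨α, hα, hαu⟩ := H2 (fun o => o.elim w0 (fun o => o.elim (y' - p0) (fun l => y' - p l))) (by
    intro o
    rcases o with _ | _ | l
    · exact hw0
    · exact sub_ne_zero.2 hy'0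
    · exact norm_pos_iff.1 (hr.trans_le (hy'l l)))
  have hαw0 : α w0 ≠ 0 :=
    norm_pos_iff.1 (lt_of_lt_of_le (mul_pos hc2 (norm_pos_iff.2 hw0)) (hαu none))
  have hα0 : α y' ≠ α p0 := by
    have : 0 < ‖α (y' - p0)‖ :=
      lt_of_lt_of_le (mul_pos hc2 (norm_pos_iff.2 (sub_ne_zero.2 hy'0))) (hαu (some none))
    rw [norm_pos_iff, map_sub] at this
    exact sub_ne_zero.1 this
  have hαl : ∀ l, min (c2 * r) cβ ≤ ‖α (y' - p l)‖ := fun l =>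
    (min_le_left _ _).trans ((mul_le_mul_of_nonneg_left (hy'l l) hc2.le).trans
      (hαu (some (some l))))
  -- the direction of the first shear
  have hβx : β (s - p0) ≠ 0 := norm_pos_iff.1 hβ0
  let x := (β (s - p0))⁻¹ • (s - p0)
  have hx : β x = 1 := by simp only [x, map_smul, smul_eq_mul]; exact inv_mul_cancel₀ hβx
  let w' := x - (α x / α w0) • w0
  have hαw' : α w' = 0 := by
    simp only [w', map_sub, map_smul, smul_eq_mul]; rw [div_mul_cancel₀ _ hαw0, sub_self]
  have hβw' : β w' = 1 := by
    simp only [w', map_sub, map_smul, hβw0, hx]; simp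
  let v1 := (β s - β y') • w'
  have hαv1 : α v1 = 0 := by simp only [v1, map_smul, hαw', smul_zero]
  let y'' := y' + v1
  have hβy'' : β y'' = β s := by
    simp only [y'', v1, map_add, map_smul, hβw', smul_eq_mul]; ring
  let v2 := s - y''
  have hβv2 : β v2 = 0 := by simp only [v2, map_sub, hβy'', sub_self]
  have hβ0' : β y'' ≠ β p0 := by
    rw [hβy'']; rw [map_sub] at hβx; exact sub_ne_zero.1 hβx
  have hβl' : ∀ l, min (c2 * r) cβ ≤ ‖β (y'' - p l)‖ := by
    intro l
    rw [map_sub, hβy'', ← map_sub]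
    exact (min_le_right _ _).trans (hcβl l)
  -- uniform continuity
  let K : Set E := ⋃ l, closedBall (p l) ρ
  have hK : IsCompact K := isCompact_iUnion fun l => isCompact_closedBall _ _
  have hAMc : Continuous ((A^M)⁻¹ : Equiv.Perm E) := (S.h0.aut.pow M).2.continuous
  obtain ⟨τ, hτ, hτK⟩ := Metric.uniformContinuousOn_iff.1
    (hK.uniformContinuousOn_of_continuous hAMc.continuousOn) ε hε
  let κ := min (ρ/4) (τ/4)
  have hκ : 0 < κ := by simp only [κ]; positivity
  have hκ1 : κ ≤ ρ/4 := min_le_left _ _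
  have hκ2 : κ ≤ τ/4 := min_le_right _ _
  obtain ⟨σ1, a1, e1, f1, g1⟩ := SH y' α hα hαl hα0 v1 hαv1 κ hκ
  obtain ⟨σ2, a2, e2, f2, g2⟩ := SH y'' β hβ hβl' hβ0' v2 hβv2 κ hκ
  have key : ∀ (a b : Equiv.Perm E), (∀ l, ∀ z ∈ closedBall (p l) ρ, dist (a z) z ≤ κ) →
      (∀ l, ∀ z ∈ closedBall (p l) ρ, dist (b z) z ≤ κ) → ∀ z ∈ L,
      dist ((A^M)⁻¹ (b (a ((A^M) z)))) z ≤ ε := by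
    intro a b ha hb z hz
    obtain ⟨l, hl⟩ := hM z hz
    set z' := (A^M) z with hz'
    have hd : dist z' (p l) < ρ/2 := hl
    have m1 : z' ∈ closedBall (p l) ρ := by rw [mem_closedBall]; linarith
    have d1 := ha l z' m1
    have m2 : a z' ∈ closedBall (p l) ρ := by
      rw [mem_closedBall]; have := dist_triangle (a z') z' (p l); linarith
    have d2 := hb l _ m2
    have m3 : b (a z') ∈ closedBall (p l) ρ := by
      rw [mem_closedBall]
      have := dist_triangle (b (a z')) (a z') (p l)
      have := dist_triangle (a z') z' (p l); linarith
    have d3 : dist (b (a z')) z' < τ := by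
      have := dist_triangle (b (a z')) (a z') z'; linarith
    have := hτK _ (mem_iUnion.2 ⟨l, m3⟩) _ (mem_iUnion.2 ⟨l, m1⟩) d3
    rw [hz', Equiv.Perm.inv_def, Equiv.symm_apply_apply, ← Equiv.Perm.inv_def] at this
    exact this.le
  refine ⟨(A^M)⁻¹ * (σ2 * σ1) * A^M, ?_, ?_, ?_, fun z hz => ⟨?_, ?_⟩⟩
  · exact ((S.h0.aut.pow M).inv.mul (a2.mul a1)).mul (S.h0.aut.pow M)
  · simp only [Equiv.Perm.mul_apply]
    rw [S.h0.fix_pow, f1, f2, Equiv.Perm.inv_eq_iff_eq, S.h0.fix_pow]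
  · refine ⟨M, ?_⟩
    simp only [Equiv.Perm.mul_apply]
    rw [Equiv.Perm.inv_def, Equiv.apply_symm_apply, ← hy', e1]
    have : σ2 (y' + v1) = s := by rw [e2]; simp only [v2]; abel
    rw [this]; exact hs
  · exact key σ1 σ2 (fun l z hz => (g1 l z hz).1) (fun l z hz => (g2 l z hz).1) z hz
  · have := key σ2⁻¹ σ1⁻¹ (fun l z hz => (g2 l z hz).2) (fun l z hz => (g1 l z hz).2) z hz
    have e : ((A^M)⁻¹ * (σ2 * σ1) * A^M)⁻¹ = (A^M)⁻¹ * (σ1⁻¹ * σ2⁻¹) * A^M := by group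
    rw [e]
    exact this

end propP

section recursion
open scoped Topology

variable {E : Type*} [NormedAddCommGroup E] [NormedSpace ℂ E]
variable {A : Equiv.Perm E} {p0 : E} {m : ℕ} {p : Fin m → E} {C r : ℝ}

theorem Setup.open_WW (S : Setup A p0 p C r) : IsOpen (WW A p r) :=
  isOpen_iUnion fun l => basin_open (S.h l).aut _ _

theorem Setup.p0_basin (S : Setup A p0 p C r) {z : E} (hz : z ∈ basin A p0 r) :
    z ∉ WW A p r := by
  intro h
  obtain ⟨l, hl⟩ := mem_iUnion.1 h
  exact (S.h l).disj S.h0 (S.ne0 l) hl hz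

theorem Setup.p0_not (S : Setup A p0 p C r) : p0 ∉ WW A p r :=
  S.p0_basin (AttrData.ball_subset (mem_ball_self S.h0.hr))

/-- Invariant of the recursion. -/
structure RecInv (p0 : E) (W : Set E) (Γ : Equiv.Perm E) (L : Set E) (η : ℝ) : Prop where
  aut : IsAut Γ
  fix : Γ p0 = p0
  cpt : IsCompact L
  pos : 0 < η
  thick : cthickening η L ⊆ W

theorem Setup.bad_point (S : Setup A p0 p C r) {Γ : Equiv.Perm E}
    (hΓ : IsAut Γ) (hfix : Γ p0 = p0) {c : E} {ρ : ℝ} (hρ : 0 < ρ)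
    (hbad : ¬ ∀ q ∈ closedBall c ρ, Γ⁻¹ q ∈ WW A p r) :
    ∃ q ∈ closedBall c (2 * ρ), Γ⁻¹ q ∉ WW A p r ∧ Γ⁻¹ q ≠ p0 := by
  have hfix' : Γ⁻¹ p0 = p0 := by rw [Equiv.Perm.inv_eq_iff_eq, hfix]
  push Not at hbad
  obtain ⟨q, hq, hqW⟩ := hbad
  have hq' : dist q c ≤ ρ := hq
  by_cases hqp : Γ⁻¹ q = p0
  · have hqp0 : q = p0 := by rw [Equiv.Perm.inv_eq_iff_eq, hfix] at hqp; exact hqp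
    obtain ⟨w, hw, -⟩ := S.ker 0
    haveI : Nontrivial E := ⟨w, 0, hw⟩
    haveI : (𝓝[≠] p0).NeBot := Module.punctured_nhds_neBot ℂ E p0
    have h1 : ∀ᶠ x in 𝓝 p0, Γ⁻¹ x ∈ basin A p0 r := by
      refine hΓ.2.continuous.continuousAt.eventually_mem ?_
      rw [hfix']
      exact (basin_open S.h0.aut p0 r).mem_nhds (AttrData.ball_subset (mem_ball_self S.h0.hr))
    have h2 : ∀ᶠ x in 𝓝 p0, x ∈ ball p0 ρ := ball_mem_nhds _ hρ
    obtain ⟨x, ⟨hx1, hx2⟩, hx3⟩ := (((h1.and h2).filter_mono nhdsWithin_le_nhds).and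
      (self_mem_nhdsWithin (s := {p0}ᶜ) (a := p0))).exists
    refine ⟨x, ?_, S.p0_basin hx1, ?_⟩
    · rw [mem_closedBall]
      have := dist_triangle x p0 c
      have h3 : dist x p0 < ρ := hx2
      rw [hqp0] at hq'
      linarith
    · intro h
      rw [Equiv.Perm.inv_eq_iff_eq, hfix] at h
      exact hx3 h
  · exact ⟨q, by rw [mem_closedBall]; linarith, hqW, hqp⟩

theorem Setup.step [ProperSpace E] (S : Setup A p0 p C r) {Γ : Equiv.Perm E} {L : Set E} {η : ℝ}
    (h : RecInv p0 (WW A p r) Γ L η) {X : Set E} (hX : IsCompact X) (hXW : X ⊆ WW A p r)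
    (c : E) {ρ : ℝ} (hρ : 0 < ρ) (i : Fin m) :
    ∃ (Γ' : Equiv.Perm E) (L' : Set E) (η' : ℝ), RecInv p0 (WW A p r) Γ' L' η' ∧
      η' ≤ η / 2 ∧ cthickening η L ⊆ L' ∧ X ⊆ L' ∧
      (∀ z ∈ L, dist ((Γ⁻¹ * Γ') z) z ≤ η / 2 ∧ dist ((Γ⁻¹ * Γ')⁻¹ z) z ≤ η / 2) ∧
      ((∀ q ∈ closedBall c ρ, Γ'⁻¹ q ∈ L') ∨
        ∃ q ∈ closedBall c (2 * ρ), Γ'⁻¹ q ∈ L' ∧ closedBall (Γ'⁻¹ q) η' ⊆ basin A (p i) r) := by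
  have hη := h.pos
  have hbase : IsCompact (cthickening η L ∪ X) := h.cpt.cthickening.union hX
  have hbaseW : cthickening η L ∪ X ⊆ WW A p r := union_subset h.thick hXW
  by_cases hgood : ∀ q ∈ closedBall c ρ, Γ⁻¹ q ∈ WW A p r
  · let L' := (cthickening η L ∪ X) ∪ (Γ⁻¹ : Equiv.Perm E) '' closedBall c ρ
    have hL' : IsCompact L' :=
      hbase.union ((isCompact_closedBall _ _).image h.aut.2.continuous)
    have hL'W : L' ⊆ WW A p r := union_subset hbaseW (by rintro _ ⟨q, hq, rfl⟩; exact hgood q hq)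
    obtain ⟨δ, hδ, hδW⟩ := hL'.exists_cthickening_subset_open S.open_WW hL'W
    refine ⟨Γ, L', min δ (η/2), ⟨h.aut, h.fix, hL', lt_min hδ (by positivity), ?_⟩,
      min_le_right _ _, ?_, ?_, ?_, Or.inl ?_⟩
    · exact (cthickening_mono (min_le_left _ _) _).trans hδW
    · exact subset_union_left.trans subset_union_left
    · exact subset_union_right.trans subset_union_left
    · intro z _
      rw [inv_mul_cancel, inv_one]
      simp only [Equiv.Perm.one_apply, dist_self]
      exact ⟨by positivity, by positivity⟩
    · intro q hq
      exact Or.inr ⟨q, hq, rfl⟩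
  · obtain ⟨q, hq, hqW, hq0⟩ := S.bad_point h.aut h.fix hρ hgood
    obtain ⟨θ, hθ, hθ0, hθq, hθL⟩ := S.propP h.cpt ((self_subset_cthickening L).trans h.thick)
      (half_pos hη) hqW hq0 i
    let y := θ (Γ⁻¹ q)
    let L' := (cthickening η L ∪ X) ∪ {y}
    have hL' : IsCompact L' := hbase.union isCompact_singleton
    have hL'W : L' ⊆ WW A p r := union_subset hbaseW (by
      rintro _ rfl; exact mem_iUnion.2 ⟨i, hθq⟩)
    obtain ⟨δ, hδ, hδW⟩ := hL'.exists_cthickening_subset_open S.open_WW hL'W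
    obtain ⟨δ2, hδ2, hδ2W⟩ := Metric.nhds_basis_closedBall.mem_iff.1
      ((basin_open (S.h i).aut (p i) r).mem_nhds hθq)
    have e : (Γ * θ⁻¹)⁻¹ q = y := by simp [y]
    refine ⟨Γ * θ⁻¹, L', min (min δ δ2) (η/2), ⟨h.aut.mul hθ.inv, ?_, hL',
      lt_min (lt_min hδ hδ2) (by positivity), ?_⟩, min_le_right _ _, ?_, ?_, ?_,
      Or.inr ⟨q, hq, ?_, ?_⟩⟩
    · rw [Equiv.Perm.mul_apply]
      have : θ⁻¹ p0 = p0 := by rw [Equiv.Perm.inv_eq_iff_eq, hθ0]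
      rw [this, h.fix]
    · exact (cthickening_mono ((min_le_left _ _).trans (min_le_left _ _)) _).trans hδW
    · exact subset_union_left.trans subset_union_left
    · exact subset_union_right.trans subset_union_left
    · intro z hz
      rw [inv_mul_cancel_left, inv_inv]
      exact ⟨(hθL z hz).2, (hθL z hz).1⟩
    · rw [e]; exact Or.inr rfl
    · rw [e]
      exact (closedBall_subset_closedBall ((min_le_left _ _).trans (min_le_right _ _))).trans hδ2W

theorem exists_exhaustion [ProperSpace E] {W : Set E} (hW : IsOpen W) :
    ∃ X : ℕ → Set E, (∀ n, IsCompact (X n)) ∧ (∀ n, X n ⊆ W) ∧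
      ∀ K ⊆ W, IsCompact K → ∃ N, ∀ n ≥ N, K ⊆ X n := by
  refine ⟨fun n => closedBall 0 n ∩ (thickening (1 / ((n:ℝ) + 1)) Wᶜ)ᶜ, fun n => ?_, fun n => ?_,
    fun K hKW hK => ?_⟩
  · exact (isCompact_closedBall _ _).inter_right isOpen_thickening.isClosed_compl
  · rintro z ⟨-, hz⟩
    by_contra hzW
    exact hz (self_subset_thickening (by positivity) _ hzW)
  · obtain ⟨δ, hδ, hd⟩ := (disjoint_compl_right_iff_subset.2 hKW).exists_thickenings hK
      hW.isClosed_compl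
    obtain ⟨R, hR⟩ := hK.isBounded.subset_closedBall 0
    obtain ⟨N1, hN1⟩ := exists_nat_ge R
    obtain ⟨N2, hN2⟩ := exists_nat_one_div_lt hδ
    refine ⟨max N1 N2, fun n hn z hz => ⟨?_, fun hz' => ?_⟩⟩
    · refine closedBall_subset_closedBall ?_ (hR hz)
      have : (N1:ℝ) ≤ n := by exact_mod_cast (le_max_left _ _).trans hn
      linarith
    · have h1 : (1:ℝ) / (n + 1) ≤ δ := by
        have : (N2:ℝ) ≤ n := by exact_mod_cast (le_max_right _ _).trans hn
        refine le_trans ?_ hN2.le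
        gcongr
      exact disjoint_left.1 hd (self_subset_thickening hδ _ hz) (thickening_mono h1 _ hz')

set_option maxHeartbeats 1000000 in
/-- Conclusion of the recursion. -/
theorem Setup.final [ProperSpace E] (S : Setup A p0 p C r) (hm : 1 ≤ m) :
    ∃ G : E → E, DifferentiableOn ℂ G (WW A p r) ∧ InjOn G (WW A p r) ∧
      p0 ∉ G '' (WW A p r) ∧ (∀ V ⊆ WW A p r, IsOpen V → IsOpen (G '' V)) ∧
      ∀ i, ∀ q ∉ G '' (WW A p r), q ∈ closure (G '' basin A (p i) r) := by
  set W := WW A p r with hWdef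
  obtain ⟨X, hXc, hXW, hX⟩ := exists_exhaustion S.open_WW
  haveI : Nonempty (Fin m) := ⟨⟨0, hm⟩⟩
  obtain ⟨T, hT⟩ := exists_surjective_nat (ℕ × ℕ × Fin m)
  let ce : ℕ → E := fun n => TopologicalSpace.denseSeq E (T n).1
  let ra : ℕ → ℝ := fun n => 1 / (((T n).2.1 : ℝ) + 1)
  have hra : ∀ n, 0 < ra n := fun n => by simp only [ra]; positivity
  let ix : ℕ → Fin m := fun n => (T n).2.2
  let St := {s : Equiv.Perm E × Set E × ℝ // RecInv p0 W s.1 s.2.1 s.2.2}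
  have hstep : ∀ (n : ℕ) (s : St), ∃ s' : St,
      s'.1.2.2 ≤ s.1.2.2 / 2 ∧ cthickening s.1.2.2 s.1.2.1 ⊆ s'.1.2.1 ∧ X (n+1) ⊆ s'.1.2.1 ∧
      (∀ z ∈ s.1.2.1, dist ((s.1.1⁻¹ * s'.1.1) z) z ≤ s.1.2.2 / 2 ∧
        dist ((s.1.1⁻¹ * s'.1.1)⁻¹ z) z ≤ s.1.2.2 / 2) ∧
      ((∀ q ∈ closedBall (ce n) (ra n), s'.1.1⁻¹ q ∈ s'.1.2.1) ∨
        ∃ q ∈ closedBall (ce n) (2 * ra n), s'.1.1⁻¹ q ∈ s'.1.2.1 ∧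
          closedBall (s'.1.1⁻¹ q) s'.1.2.2 ⊆ basin A (p (ix n)) r) := by
    rintro n ⟨⟨Γ, L, η⟩, hs⟩
    obtain ⟨Γ', L', η', h1, h2⟩ := S.step hs (hXc (n+1)) (hXW (n+1)) (ce n) (hra n) (ix n)
    exact ⟨⟨⟨Γ', L', η'⟩, h1⟩, h2⟩
  choose nxt hn1 hn2 hn3 hn4 hn5 using hstep
  let s0 : St := ⟨⟨1, ∅, 1⟩, ⟨IsAut.one, rfl, isCompact_empty, one_pos, by
    simp [cthickening_empty]⟩⟩
  let s : ℕ → St := fun n => Nat.rec s0 (fun n x => nxt n x) n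
  have hs : ∀ n, s (n+1) = nxt n (s n) := fun n => rfl
  let Γ : ℕ → Equiv.Perm E := fun n => (s n).1.1
  let L : ℕ → Set E := fun n => (s n).1.2.1
  let η : ℕ → ℝ := fun n => (s n).1.2.2
  have inv : ∀ n, RecInv p0 W (Γ n) (L n) (η n) := fun n => (s n).2
  have k1 : ∀ n, η (n+1) ≤ η n / 2 := fun n => hn1 n (s n)
  have k2 : ∀ n, cthickening (η n) (L n) ⊆ L (n+1) := fun n => hn2 n (s n)
  have k3 : ∀ n, X (n+1) ⊆ L (n+1) := fun n => hn3 n (s n)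
  have k4 : ∀ n, ∀ z ∈ L n, dist (((Γ n)⁻¹ * Γ (n+1)) z) z ≤ η n / 2 ∧
        dist (((Γ n)⁻¹ * Γ (n+1))⁻¹ z) z ≤ η n / 2 := fun n => hn4 n (s n)
  have k5 : ∀ n, (∀ q ∈ closedBall (ce n) (ra n), (Γ (n+1))⁻¹ q ∈ L (n+1)) ∨
        ∃ q ∈ closedBall (ce n) (2 * ra n), (Γ (n+1))⁻¹ q ∈ L (n+1) ∧
          closedBall ((Γ (n+1))⁻¹ q) (η (n+1)) ⊆ basin A (p (ix n)) r := fun n => hn5 n (s n)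
  clear_value Γ L η
  clear hs hn1 hn2 hn3 hn4 hn5
  have hη : ∀ n j, η (n + j) ≤ η n * (1/2)^j := by
    intro n j
    induction j with
    | zero => simp
    | succ j ih =>
      have := k1 (n + j)
      rw [← add_assoc, pow_succ]
      linarith
  have hηs : ∀ n, Summable (fun j => η n * (1/2 : ℝ)^j / 2) := fun n =>
    ((summable_geometric_of_lt_one (by norm_num) (by norm_num)).mul_left _).div_const _
  have hLm : Monotone L := monotone_nat_of_le_succ fun n =>
    (self_subset_cthickening _).trans (k2 n)
  have PD : PushData W Γ (fun n => (Γ n)⁻¹ * Γ (n+1)) L (fun n => η n / 2) :=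
    { open_W := S.open_WW
      step := fun n => by simp
      autΓ := fun n => (inv n).aut
      sum := by
        refine Summable.of_nonneg_of_le (fun n => by have := (inv n).pos; positivity)
          (fun n => ?_) (hηs 0)
        have := hη 0 n
        rw [zero_add] at this
        linarith
      nonneg := fun n => by have := (inv n).pos; positivity
      fwd := fun n z hz => (k4 n z hz).1
      bwd := fun n z hz => (k4 n z hz).2
      exh := fun K hKW hK => by
        obtain ⟨N, hN⟩ := hX K hKW hK
        refine ⟨N + 1, fun n hn => ?_⟩
        obtain ⟨n, rfl⟩ : ∃ n', n = n' + 1 := ⟨n - 1, by omega⟩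
        exact (hN (n+1) (by omega)).trans (k3 n) }
  have htail : ∀ n, PushData.tail (fun n => η n / 2) n ≤ η n := by
    intro n
    unfold PushData.tail
    have h1 : ∑' j, η (n + j) / 2 ≤ ∑' j : ℕ, η n * (1/2 : ℝ)^j / 2 := by
      refine (PD.summable_add n).tsum_le_tsum (fun j => ?_) (hηs n)
      have := hη n j
      linarith
    refine h1.trans (le_of_eq ?_)
    rw [tsum_div_const, tsum_mul_left, tsum_geometric_of_lt_one (by norm_num) (by norm_num)]
    norm_num
  obtain ⟨G, hGd, hGi, hGt, hGc, hGo⟩ := PD.main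
  have capt : ∀ n q, (Γ (n+1))⁻¹ q ∈ L (n+1) →
      ∃ z ∈ closedBall ((Γ (n+1))⁻¹ q) (η (n+1)), G z = q := by
    intro n q hq
    refine hGc q (n+1) (η (n+1)) hq (fun j hj => ?_) ?_ (htail _)
    · exact (closedBall_subset_cthickening hq _).trans ((k2 (n+1)).trans (hLm (show n + 1 + 1 ≤ j from hj)))
    · exact (closedBall_subset_cthickening hq _).trans (inv (n+1)).thick
  refine ⟨G, hGd, hGi, ?_, hGo, fun i q hq => ?_⟩
  · rintro ⟨z, hz, hzp⟩
    have h1 := hGt z hz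
    have h2 : ∀ n, (Γ n)⁻¹ (G z) = p0 := fun n => by
      rw [hzp, Equiv.Perm.inv_eq_iff_eq, (inv n).fix]
    simp only [h2] at h1
    have h3 : p0 = z := tendsto_nhds_unique tendsto_const_nhds h1
    exact S.p0_not (h3 ▸ hz)
  · rw [Metric.mem_closure_iff]
    intro ε hε
    obtain ⟨b, hb⟩ := exists_nat_one_div_lt (show (0:ℝ) < ε / 3 by positivity)
    obtain ⟨x, hx, a, rfl⟩ := Metric.dense_iff.1 (TopologicalSpace.denseRange_denseSeq E) q
      (1 / ((b:ℝ) + 1)) (by positivity)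
    obtain ⟨n, hn⟩ := hT (a, b, i)
    have e1 : ce n = TopologicalSpace.denseSeq E a := by simp only [ce, hn]
    have e2 : ra n = 1 / ((b:ℝ) + 1) := by simp only [ra, hn]
    have e3 : ix n = i := by simp only [ix, hn]
    have hdq : dist (ce n) q < ra n := by rw [e1, e2]; exact hx
    rcases k5 n with hA | ⟨q', hq', hq'L, hq'b⟩
    · exfalso
      have hqm : q ∈ closedBall (ce n) (ra n) := by
        rw [mem_closedBall, dist_comm]; exact hdq.le
      obtain ⟨z, hz, hzq⟩ := capt n q (hA q hqm)
      exact hq ⟨z, (inv (n+1)).thick (closedBall_subset_cthickening (hA q hqm) _ hz), hzq⟩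
    · obtain ⟨z, hz, hzq⟩ := capt n q' hq'L
      rw [e3] at hq'b
      refine ⟨q', ⟨z, hq'b hz, hzq⟩, ?_⟩
      have h1 : dist q' (ce n) ≤ 2 * ra n := hq'
      have h2 := dist_triangle q (ce n) q'
      rw [dist_comm q (ce n), dist_comm (ce n) q'] at h2
      rw [e2] at hdq h1
      linarith

end recursion

theorem disjoint_FB_domains_dense_union (k m : ℕ) (hk : 2 ≤ k) (hm : 1 ≤ m) :
    ∃ Ω : Fin m → Set (EuclideanSpace ℂ (Fin k)),
      (∀ i, IsFBDomain (Ω i)) ∧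
      (∀ i l, i ≠ l → Ω i ∩ Ω l = ∅) ∧
      (∀ q ∉ ⋃ i, Ω i, ∀ i, q ∈ frontier (Ω i)) ∧
      Dense (⋃ i, Ω i) := by
  obtain ⟨A, P, C, r, hinj, hP⟩ := exists_attr hk m
  have hker : ∀ β : EuclideanSpace ℂ (Fin k) →L[ℂ] ℂ, ∃ w, w ≠ 0 ∧ β w = 0 := by
    intro β
    have hlt : Module.finrank ℂ ℂ < Module.finrank ℂ (EuclideanSpace ℂ (Fin k)) := by
      rw [Module.finrank_self, finrank_euclideanSpace, Fintype.card_fin]; omega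
    have h := LinearMap.ker_ne_bot_of_finrank_lt (f := (β : EuclideanSpace ℂ (Fin k) →ₗ[ℂ] ℂ)) hlt
    obtain ⟨w, hw, hw0⟩ := Submodule.exists_mem_ne_zero_of_ne_bot h
    exact ⟨w, hw0, hw⟩
  have S : Setup A (P 0) (fun l : Fin m => P l.succ) C r :=
    { h0 := hP 0
      h := fun l => hP l.succ
      inj := fun a b hab => Fin.succ_injective _ (hinj hab)
      ne0 := fun l hl => Fin.succ_ne_zero l (hinj hl)
      ker := hker }
  obtain ⟨G, hGd, hGi, hG0, hGo, hGc⟩ := S.final hm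
  have hsub : ∀ i : Fin m, basin A (P i.succ) r ⊆ WW A (fun l : Fin m => P l.succ) r :=
    fun i => subset_iUnion (fun l : Fin m => basin A (P l.succ) r) i
  have hun : ⋃ i : Fin m, G '' basin A (P i.succ) r = G '' WW A (fun l : Fin m => P l.succ) r := by
    rw [WW, image_iUnion]
  have hop : ∀ i : Fin m, IsOpen (G '' basin A (P i.succ) r) := fun i =>
    hGo _ (hsub i) (basin_open (hP 0).aut _ _)
  refine ⟨fun i => G '' basin A (P i.succ) r, fun i => ⟨hop i, ?_, ?_⟩, fun i l hil => ?_,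
    fun q hq i => ?_, ?_⟩
  · intro h
    have : P 0 ∈ G '' basin A (P i.succ) r := h.ge (mem_univ (P 0))
    exact hG0 (image_mono (hsub i) this)
  · obtain ⟨F, hF, hFi, hFr⟩ := (hP i.succ).fb
    have hFm : ∀ z, F z ∈ WW A (fun l : Fin m => P l.succ) r := fun z =>
      hsub i (hFr ▸ mem_range_self z)
    refine ⟨G ∘ F, fun z => ?_, fun a b hab => hFi (hGi (hFm a) (hFm b) hab), ?_⟩
    · exact ((hGd _ (hFm z)).differentiableAt (S.open_WW.mem_nhds (hFm z))).comp z (hF z)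
    · rw [range_comp, hFr]
  · rw [← disjoint_iff_inter_eq_empty, disjoint_left]
    rintro _ ⟨a, ha, rfl⟩ ⟨b, hb, hab⟩
    have : b = a := hGi (hsub l hb) (hsub i ha) hab
    subst this
    exact (hP i.succ).disj (hP l.succ) (fun e => hil (Fin.succ_injective _ (hinj e))) ha hb
  · rw [(hop i).frontier_eq]
    refine ⟨hGc i q (by rw [← hun]; exact hq), fun h => hq (mem_iUnion.2 ⟨i, h⟩)⟩
  · intro q
    by_cases hq : q ∈ ⋃ i : Fin m, G '' basin A (P i.succ) r
    · exact subset_closure hq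
    · exact closure_mono (subset_iUnion (fun i : Fin m => G '' basin A (P i.succ) r) ⟨0, hm⟩)
        (hGc ⟨0, hm⟩ q (by rw [← hun]; exact hq))
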